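/- arXiv:1512.04890 — 5 statements merged into one kernel-verified Lean document; each statement's English description precedes it below -/
import Mathlib

section
/- Let n ≥ 5 be a natural number. The alternating group A_n contains a proper subgroup H with exp(H) = exp(A_n) if and only if n is NOT of one of the following forms: n = 10; n = p^r for some odd prime p and r ≥ 1; or n = p_f + 1 where p_f is a Fermat prime (a prime of the form 2^(2^k) + 1). -/
set_option exponentiation.threshold 400 in
open Real in
theorem mul_mul_rpow_sqrt_mul_le_four_rpow {x : ℝ} (x_large : (512 : ℝ) ≤ x) :
    2 * x * x * (2 * x) ^ √(2 * x) * 4 ^ (2 * x / 3) ≤ 4 ^ x := by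
  let f : ℝ → ℝ := fun x => log 2 + (log x + log x) + √(2 * x) * log (2 * x) - log 4 / 3 * x
  have hf' : ∀ x, 0 < x → 0 < 2 * x * x * (2 * x) ^ √(2 * x) / 4 ^ (x / 3) :=
    fun x h => by positivity
  have hf : ∀ x, 0 < x → f x = log (2 * x * x * (2 * x) ^ √(2 * x) / 4 ^ (x / 3)) := by
    intro x h5
    have h6 := mul_pos (zero_lt_two' ℝ) h5
    have h7 := rpow_pos_of_pos h6 (√(2 * x))
    rw [log_div (by positivity) (rpow_pos_of_pos four_pos _).ne', log_mul (by positivity) h7.ne',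
      log_mul (by positivity) h5.ne', log_mul two_ne_zero h5.ne',
      log_rpow h6, log_rpow zero_lt_four]
    ring
  have h5 : 0 < x := lt_of_lt_of_le (by norm_num1) x_large
  rw [← div_le_one (rpow_pos_of_pos four_pos x), ← div_div_eq_mul_div, ← rpow_sub four_pos, ←
    mul_div 2 x, mul_div_left_comm, ← mul_one_sub, (by norm_num1 : (1 : ℝ) - 2 / 3 = 1 / 3),
    mul_one_div, ← log_nonpos_iff (hf' x h5).le, ← hf x h5]
  have h : ConcaveOn ℝ (Set.Ioi 0.5) f := by
    apply ConcaveOn.sub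
    · apply ConcaveOn.add
      · have hl : ConcaveOn ℝ (Set.Ioi 0.5) log := strictConcaveOn_log_Ioi.concaveOn.subset
          (Set.Ioi_subset_Ioi (by norm_num)) (convex_Ioi 0.5)
        exact (concaveOn_const _ (convex_Ioi 0.5)).add (hl.add hl)
      convert!
        ((strictConcaveOn_sqrt_mul_log_Ioi.concaveOn.comp_linearMap ((2 : ℝ) • LinearMap.id)))
        using 1
      ext x
      simp only [Set.mem_Ioi, Set.mem_preimage, LinearMap.smul_apply,
        LinearMap.id_coe, id_eq, smul_eq_mul]
      rw [← mul_lt_mul_iff_right₀ (two_pos)]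
      norm_num1
      rfl
    apply ConvexOn.smul
    · refine div_nonneg (log_nonneg (by norm_num1)) (by norm_num1)
    · exact convexOn_id (convex_Ioi (0.5 : ℝ))
  suffices ∃ x1 x2, 0.5 < x1 ∧ x1 < x2 ∧ x2 ≤ x ∧ 0 ≤ f x1 ∧ f x2 ≤ 0 by
    obtain ⟨x1, x2, h1, h2, h0, h3, h4⟩ := this
    exact (h.right_le_of_le_left'' h1 ((h1.trans h2).trans_le h0) h2 h0 (h4.trans h3)).trans h4
  refine ⟨18, 512, by norm_num1, by norm_num1, x_large, ?_, ?_⟩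
  · have : √(2 * 18 : ℝ) = 6 := (sqrt_eq_iff_mul_self_eq_of_pos (by norm_num1)).mpr (by norm_num1)
    rw [hf _ (by norm_num1), log_nonneg_iff (by positivity), this, one_le_div (by norm_num1)]
    norm_num1
  · have : √(2 * 512) = 32 :=
      (sqrt_eq_iff_mul_self_eq_of_pos (by norm_num1)).mpr (by norm_num1)
    rw [hf _ (by norm_num1), log_nonpos_iff (hf' _ (by norm_num1)).le, this,
        div_le_one (by positivity)]
    have h1 : (2 * 512 * 512 * (2 * 512) ^ (32 : ℝ) : ℝ) = 2 ^ (339 : ℝ) := by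
      rw [show (32 : ℝ) = (32 : ℕ) by norm_num, show (339 : ℝ) = (339 : ℕ) by norm_num,
        rpow_natCast, rpow_natCast]
      norm_num1
    rw [h1, show (4 : ℝ) = 2 ^ (2 : ℝ) by norm_num, ← rpow_mul two_pos.le]
    apply rpow_le_rpow_of_exponent_le <;> norm_num1

theorem mul_mul_pow_sqrt_mul_le_four_pow {n : ℕ} (n_large : 512 ≤ n) :
    2 * n * n * (2 * n) ^ Nat.sqrt (2 * n) * 4 ^ (2 * n / 3) ≤ 4 ^ n := by
  rw [← @Nat.cast_le ℝ]
  simp only [Nat.cast_mul, Nat.cast_pow, ← Real.rpow_natCast, Nat.cast_ofNat]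
  refine _root_.trans ?_ (mul_mul_rpow_sqrt_mul_le_four_rpow (by exact_mod_cast n_large))
  gcongr
  · have n2_pos : 0 < 2 * n := by positivity
    exact mod_cast n2_pos
  · exact_mod_cast Real.nat_sqrt_le_real_sqrt
  · norm_num1
  · exact Nat.cast_div_le.trans (by norm_cast)

/-- An upper bound for the central binomial coefficient when at most one prime lies in
`(n, 2 * n]`. -/
theorem centralBinom_le_of_unique_prime (n : ℕ) (n_large : 2 < n) (q : ℕ)
    (unique : ∀ p : ℕ, p.Prime → n < p → p ≤ 2 * n → p = q) :
    Nat.centralBinom n ≤ 2 * n * ((2 * n) ^ Nat.sqrt (2 * n) * 4 ^ (2 * n / 3)) := by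
  have n_pos : 0 < n := by omega
  have n2_pos : 1 ≤ 2 * n := by omega
  let f x := x ^ n.centralBinom.factorization x
  have hf2 : ∀ p, f p ≤ 2 * n := fun p => Nat.pow_factorization_choose_le (by omega)
  have hf1 : ∀ p, 1 ≤ f p := by
    intro p
    rcases Nat.eq_zero_or_pos p with rfl | hp
    · simp [f]
    · exact Nat.one_le_pow _ _ hp
  let A := Finset.Icc 1 (Nat.sqrt (2 * n))
  let B := {p ∈ Finset.range (2 * n / 3 + 1) | p.Prime ∧ Nat.sqrt (2 * n) < p}
  have hsub : ∀ p ∈ Finset.range (2 * n + 1), p ∉ insert q (A ∪ B) → f p = 1 := by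
    intro p hp hpn
    simp only [Finset.mem_insert, Finset.mem_union, not_or, A, B, Finset.mem_Icc,
      Finset.mem_filter, Finset.mem_range] at hp hpn
    by_cases hpp : p.Prime
    · have h1 := hpp.one_lt
      have h2 : p ≤ n := by
        by_contra h
        exact hpn.1 (unique p hpp (by omega) (by omega))
      have h3 : 2 * n < 3 * p := by
        have h4 : Nat.sqrt (2 * n) < p := by omega
        have h5 : ¬ p < 2 * n / 3 + 1 := fun h => hpn.2.2 ⟨h, hpp, h4⟩
        omega
      simp only [f]
      rw [Nat.factorization_centralBinom_of_two_mul_self_lt_three_mul n_large h2 h3, pow_zero]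
    · simp only [f]
      rw [Nat.factorization_eq_zero_of_not_prime n.centralBinom hpp, pow_zero]
  have hprod : n.centralBinom ≤ ∏ p ∈ insert q (A ∪ B), f p := by
    conv_lhs => rw [← n.prod_pow_factorization_centralBinom]
    change ∏ p ∈ Finset.range (2 * n + 1), f p ≤ _
    calc ∏ p ∈ Finset.range (2 * n + 1), f p
        ≤ ∏ p ∈ Finset.range (2 * n + 1) ∪ insert q (A ∪ B), f p :=
          Finset.prod_le_prod_of_subset_of_one_le' Finset.subset_union_left fun p _ _ => hf1 p
      _ = ∏ p ∈ insert q (A ∪ B), f p := by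
          symm
          refine Finset.prod_subset Finset.subset_union_right fun p hp hpn => ?_
          exact hsub p ((Finset.mem_union.1 hp).resolve_right hpn) hpn
  have hA : ∏ p ∈ A, f p ≤ (2 * n) ^ Nat.sqrt (2 * n) := by
    refine (Finset.prod_le_pow_card _ _ _ fun p _ => hf2 p).trans ?_
    simp [A]
  have hB : ∏ p ∈ B, f p ≤ 4 ^ (2 * n / 3) := by
    refine le_trans ?_ (primorial_le_four_pow (2 * n / 3))
    refine (Finset.prod_le_prod' fun p hp => (?_ : f p ≤ p)).trans ?_
    · obtain ⟨-, h1, h2⟩ := Finset.mem_filter.1 hp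
      exact (pow_right_mono₀ h1.one_lt.le
        (Nat.factorization_choose_le_one (Nat.sqrt_lt'.mp h2))).trans (pow_one p).le
    · refine Finset.prod_le_prod_of_subset_of_one_le' ?_ ?_
      · intro p hp
        simp only [B, Finset.mem_filter] at hp ⊢
        exact ⟨hp.1, hp.2.1⟩
      · exact fun p hp _ => (Finset.mem_filter.1 hp).2.one_lt.le
  have hAB : ∏ p ∈ A ∪ B, f p ≤ (∏ p ∈ A, f p) * ∏ p ∈ B, f p := by
    rw [← Finset.prod_union_inter]
    exact Nat.le_mul_of_pos_right _ (Finset.prod_pos fun p _ => hf1 p)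
  have hq : ∏ p ∈ insert q (A ∪ B), f p ≤ f q * ∏ p ∈ A ∪ B, f p := by
    by_cases h : q ∈ A ∪ B
    · rw [Finset.insert_eq_of_mem h]
      exact Nat.le_mul_of_pos_left _ (hf1 q)
    · rw [Finset.prod_insert h]
  exact hprod.trans (hq.trans (Nat.mul_le_mul (hf2 q) (hAB.trans (Nat.mul_le_mul hA hB))))

/-- A slight strengthening of Bertrand's postulate. -/
theorem exists_prime_lt_and_add_three_le_two_mul {n : ℕ} (hn : 4 ≤ n) :
    ∃ p, p.Prime ∧ n < p ∧ p + 3 ≤ 2 * n := by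
  rcases lt_or_ge n 512 with h | h
  · have step : ∀ p a, p.Prime → p + 3 ≤ 2 * a → a ≤ n → n < p →
        ∃ p, p.Prime ∧ n < p ∧ p + 3 ≤ 2 * n := fun p a hp h1 h2 h3 => ⟨p, hp, h3, by omega⟩
    rcases lt_or_ge n 5 with h1 | h1
    · exact step 5 4 (by norm_num1) le_rfl hn h1
    rcases lt_or_ge n 7 with h2 | h2
    · exact step 7 5 (by norm_num1) le_rfl h1 h2
    rcases lt_or_ge n 11 with h3 | h3
    · exact step 11 7 (by norm_num1) le_rfl h2 h3
    rcases lt_or_ge n 19 with h4 | h4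
    · exact step 19 11 (by norm_num1) le_rfl h3 h4
    rcases lt_or_ge n 31 with h5 | h5
    · exact step 31 19 (by norm_num1) (by norm_num1) h4 h5
    rcases lt_or_ge n 53 with h6 | h6
    · exact step 53 31 (by norm_num1) (by norm_num1) h5 h6
    rcases lt_or_ge n 97 with h7 | h7
    · exact step 97 53 (by norm_num1) (by norm_num1) h6 h7
    rcases lt_or_ge n 181 with h8 | h8
    · exact step 181 97 (by norm_num1) (by norm_num1) h7 h8
    rcases lt_or_ge n 331 with h9 | h9
    · exact step 331 181 (by norm_num1) (by norm_num1) h8 h9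
    · exact step 631 331 (by norm_num1) (by norm_num1) h9 (by omega)
  · by_contra! hno
    have hlow := Nat.four_pow_lt_mul_centralBinom n hn
    have hup := centralBinom_le_of_unique_prime n (by omega) (2 * n - 1) fun p hp h1 h2 => by
      have h3 := hno p hp h1
      have h4 := hp.eq_two_or_odd
      omega
    have := mul_mul_pow_sqrt_mul_le_four_pow h
    have h2 := Nat.mul_le_mul_left n hup
    have h3 : n * (2 * n * ((2 * n) ^ Nat.sqrt (2 * n) * 4 ^ (2 * n / 3))) =
      2 * n * n * (2 * n) ^ Nat.sqrt (2 * n) * 4 ^ (2 * n / 3) := by ring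
    omega

section
open MulAction Equiv Equiv.Perm

variable {α : Type*} [Fintype α] [DecidableEq α]

theorem coe_ofFixingSubgroup_compl_support (G : Subgroup (Perm α)) (c : Perm α) :
    (SubMulAction.ofFixingSubgroup G (c.support : Set α)ᶜ : Set α) = c.support := by
  ext x
  simp [SubMulAction.mem_ofFixingSubgroup_iff]

theorem card_ofFixingSubgroup_compl_support (G : Subgroup (Perm α)) (c : Perm α) :
    Nat.card (SubMulAction.ofFixingSubgroup G (c.support : Set α)ᶜ) = c.support.card :=
  (congrArg Set.ncard (coe_ofFixingSubgroup_compl_support G c)).trans (Set.ncard_coe_finset _)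

theorem isPreprimitive_fixingSubgroup_of_isCycle_prime {G : Subgroup (Perm α)}
    {c : Perm α} (hc : c.IsCycle) (hcG : c ∈ G) (hp : c.support.card.Prime) :
    IsPreprimitive (fixingSubgroup G (c.support : Set α)ᶜ)
      (SubMulAction.ofFixingSubgroup G (c.support : Set α)ᶜ) :=
  IsPreprimitive.of_prime_card (hGX := isPretransitive_of_isCycle_mem hc hcG)
    (card_ofFixingSubgroup_compl_support G c ▸ hp)

theorem isPreprimitive_of_isCycle_prime {G : Subgroup (Perm α)} [IsPretransitive G α]
    {c : Perm α} (hc : c.IsCycle) (hcG : c ∈ G) (hp : c.support.card.Prime)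
    (hlt : Fintype.card α < 2 * c.support.card) : IsPreprimitive G α := by
  have := isPreprimitive_fixingSubgroup_of_isCycle_prime hc hcG hp
  let f : SubMulAction.ofFixingSubgroup G (c.support : Set α)ᶜ
      →ₑ[(fixingSubgroup G (c.support : Set α)ᶜ).subtype] α :=
    { toFun := fun x => x, map_smul' := fun _ _ => rfl }
  refine IsPreprimitive.of_card_lt (f := f) ?_
  have : Set.range f = c.support :=
    Subtype.range_coe.trans (coe_ofFixingSubgroup_compl_support G c)
  rw [this, Set.ncard_coe_finset, Nat.card_eq_fintype_card]
  exact hlt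

theorem isMultiplyPretransitive_of_isCycle_prime {G : Subgroup (Perm α)} (hG : IsPreprimitive G α)
    {c : Perm α} (hc : c.IsCycle) (hcG : c ∈ G) (hp : c.support.card.Prime)
    (hlt : c.support.card < Fintype.card α) :
    IsMultiplyPretransitive G α (Fintype.card α - c.support.card) := by
  have hn : ((c.support : Set α)ᶜ).ncard = (Fintype.card α - c.support.card - 1) + 1 := by
    rw [← Finset.coe_compl, Set.ncard_coe_finset, Finset.card_compl]; omega
  have h2 := hp.two_le
  have := hG.isMultiplyPreprimitive hn (by rw [Nat.card_eq_fintype_card]; omega)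
    (isPreprimitive_fixingSubgroup_of_isCycle_prime hc hcG hp)
  exact isMultiplyPretransitive_of_le (n := Fintype.card α - c.support.card - 1 + 2)
    (by omega) (by rw [Nat.card_eq_fintype_card]; omega)

theorem exists_normalizing_extension {G : Subgroup (Perm α)} {c : Perm α} (hc : c.IsCycle)
    (hcG : c ∈ G) (hp : c.support.card.Prime)
    (hG : IsMultiplyPretransitive G α (Fintype.card α - c.support.card))
    (π : Perm α) (hπ : ∀ x, c x = x → c (π x) = π x) :
    ∃ g ∈ G, (∀ x, c x = x → g x = π x) ∧ ∃ e : ℤ, g * c * g⁻¹ = c ^ e := by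
  set q := c.support.card with hq
  have : Fact q.Prime := ⟨hp⟩
  let F : Set α := (c.support : Set α)ᶜ
  have hF : ∀ x, x ∈ F ↔ c x = x := by intro x; simp [F]
  have hFcard : F.ncard = Fintype.card α - q := by
    simp only [F]
    rw [← Finset.coe_compl, Set.ncard_coe_finset, Finset.card_compl]
  have hqle : q ≤ Fintype.card α := Finset.card_le_univ _
  obtain ⟨g, hgG, hg⟩ : ∃ g ∈ G, ∀ x ∈ F, g x = π x := by
    have e : Fin (Fintype.card α - q) ≃ F := by
      rw [← hFcard]
      exact (Finite.equivFin F).symm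
    have h := (isMultiplyPretransitive_iff.mp hG)
      (e.toEmbedding.trans (Function.Embedding.subtype _))
      ((e.toEmbedding.trans (Function.Embedding.subtype _)).trans π.toEmbedding)
    obtain ⟨g, hg⟩ := h
    refine ⟨g, g.2, fun x hx => ?_⟩
    have := DFunLike.congr_fun hg (e.symm ⟨x, hx⟩)
    simp at this
    exact this
  let K : Subgroup (Perm α) := G ⊓ fixingSubgroup (Perm α) F
  have hK : ∀ {k}, k ∈ K ↔ k ∈ G ∧ ∀ x ∈ F, k x = x := by
    intro k; simp [K, Subgroup.mem_inf, mem_fixingSubgroup_iff]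
  have hcK : c ∈ K := hK.2 ⟨hcG, fun x hx => (hF x).1 hx⟩
  have hcK' : g⁻¹ * c * g ∈ K := by
    refine hK.2 ⟨mul_mem (mul_mem (inv_mem hgG) hcG) hgG, fun x hx => ?_⟩
    have h1 := hπ x ((hF x).1 hx)
    simp only [Perm.mul_apply, hg x hx, h1]
    rw [← hg x hx]; simp
  have hKdvd : Nat.card K ∣ q.factorial := by
    have h1 : Nat.card K ∣ Nat.card (fixingSubgroup (Perm α) F) :=
      Subgroup.card_dvd_of_le inf_le_right
    have h2 := (Perm.isMultiplyPretransitive α F.ncard).index_of_fixingSubgroup_mul rfl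
    rw [hFcard, Nat.card_eq_fintype_card (α := α), Nat.sub_sub_self hqle] at h2
    have h3 := (fixingSubgroup (Perm α) F).card_mul_index
    rw [Nat.card_perm, Nat.card_eq_fintype_card (α := α), ← h2, mul_comm] at h3
    have h4 := Nat.eq_of_mul_eq_mul_left (Nat.pos_of_ne_zero Subgroup.index_ne_zero_of_finite) h3
    rwa [← h4]
  have hord : orderOf c = q := hc.orderOf
  have hfac : (Nat.card K).factorization q = 1 := by
    apply le_antisymm
    · have h1 := (Nat.factorization_le_iff_dvd Nat.card_pos.ne' (Nat.factorial_ne_zero q)).2 hKdvd q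
      refine h1.trans ?_
      have := Nat.factorization_factorial_mul (p := q) (n := 1) hp
      rw [mul_one] at this
      rw [this]
      simp
    · have : q ∣ Nat.card K := by
        rw [← hord, ← Subgroup.orderOf_mk c hcK]
        exact orderOf_dvd_natCard _
      exact (hp.dvd_iff_one_le_factorization Nat.card_pos.ne').1 this
  have hsyl : ∀ d : K, orderOf d = q → Nat.card (Subgroup.zpowers d)
      = q ^ (Nat.card K).factorization q := by
    intro d hd
    rw [Nat.card_zpowers, hd, hfac, pow_one]
  let P : Sylow q K := Sylow.ofCard _ (hsyl ⟨c, hcK⟩ (by rw [Subgroup.orderOf_mk, hord]))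
  let Q : Sylow q K := Sylow.ofCard _ (hsyl ⟨g⁻¹ * c * g, hcK'⟩ (by
    rw [Subgroup.orderOf_mk, ← hord]
    exact orderOf_injective (MulAut.conj g⁻¹).toMonoidHom (MulAut.conj g⁻¹).injective c ▸ by simp))
  obtain ⟨k, hk⟩ := MulAction.exists_smul_eq K P Q
  have hmem : k * ⟨c, hcK⟩ * k⁻¹ ∈ Subgroup.zpowers (⟨g⁻¹ * c * g, hcK'⟩ : K) := by
    have : k * ⟨c, hcK⟩ * k⁻¹ ∈ (k • P : Sylow q K) :=
      Subgroup.smul_mem_pointwise_smul _ (MulAut.conj k) _ (Subgroup.mem_zpowers _)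
    rw [hk] at this
    exact this
  obtain ⟨e, he⟩ := Subgroup.mem_zpowers_iff.1 hmem
  have he' : (g⁻¹ * c * g) ^ e = (k : Perm α) * c * (k : Perm α)⁻¹ := by
    simpa using congrArg (Subtype.val) he
  refine ⟨g * k, mul_mem hgG (hK.1 k.2).1, fun x hx => ?_, e, ?_⟩
  · rw [Perm.mul_apply, (hK.1 k.2).2 x ((hF x).2 hx), hg x ((hF x).2 hx)]
  · have h5 : (g⁻¹ * c * g) ^ e = g⁻¹ * c ^ e * g := by
      have := conj_zpow (i := e) (a := g⁻¹) (b := c)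
      simpa using this
    rw [h5] at he'
    rw [mul_inv_rev, show g * ↑k * c * ((↑k)⁻¹ * g⁻¹) = g * (k * c * (k : Perm α)⁻¹) * g⁻¹ by group,
      ← he']
    group

theorem alternatingGroup_le_of_isCycle_prime {G : Subgroup (Perm α)} (hG : IsPreprimitive G α)
    {c : Perm α} (hc : c.IsCycle) (hcG : c ∈ G) (hp : c.support.card.Prime)
    (hlt : c.support.card + 3 ≤ Fintype.card α) : alternatingGroup α ≤ G := by
  by_cases h3 : c.support.card = 3
  · exact alternatingGroup_le_of_isPreprimitive_of_isThreeCycle_mem hG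
      (card_support_eq_three_iff.1 h3) hcG
  have hmt := isMultiplyPretransitive_of_isCycle_prime hG hc hcG hp (by omega)
  obtain ⟨a, b, d, ha, hb, hd, hab, had, hbd⟩ : ∃ a b d, a ∈ c.supportᶜ ∧ b ∈ c.supportᶜ ∧
      d ∈ c.supportᶜ ∧ a ≠ b ∧ a ≠ d ∧ b ≠ d :=
    Finset.two_lt_card_iff.1 (by rw [Finset.card_compl]; omega)
  simp only [Finset.mem_compl, Perm.notMem_support] at ha hb hd
  have hsw : ∀ {u v}, c u = u → c v = v → ∀ x, c x = x → c (swap u v x) = swap u v x := by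
    intro u v hu hv x hx
    rw [swap_apply_def]
    split_ifs <;> assumption
  obtain ⟨g, hgG, hg, e, hge⟩ := exists_normalizing_extension hc hcG hp hmt _ (hsw hb ha)
  obtain ⟨h, hhG, hh, f, hhf⟩ := exists_normalizing_extension hc hcG hp hmt _ (hsw hb hd)
  have hinv : ∀ {k : Perm α} {u v}, c u = u → c v = v → (∀ x, c x = x → k x = swap u v x) →
      ∀ x, c x = x → k⁻¹ x = swap u v x := by
    intro k u v hu hv hk x hx
    rw [Perm.inv_eq_iff_eq, hk _ (hsw hu hv x hx), swap_apply_self]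
  set s := swap b a * swap b d with hs
  have hs3 : IsThreeCycle (s * s) :=
    (isThreeCycle_swap_mul_swap_same hab.symm hbd had).isThreeCycle_sq
  set t := g⁻¹ * h⁻¹ * g * h with ht
  have htF : ∀ x, c x = x → t x = (s * s) x := by
    intro x hx
    have h1 := hsw hb hd x hx
    have h2 := hsw hb ha _ h1
    have h3 := hsw hb hd _ h2
    simp only [ht, hs, Perm.mul_apply]
    rw [hh x hx, hg _ h1, hinv hb hd hh _ h2, hinv hb ha hg _ h3]
  have hsF : ∀ x, c x = x → c ((s * s) x) = (s * s) x := by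
    intro x hx
    simp only [hs, Perm.mul_apply]
    exact hsw hb ha _ (hsw hb hd _ (hsw hb ha _ (hsw hb hd _ hx)))
  have hsF' : ∀ x, c x ≠ x → (s * s) x = x := by
    intro x hx
    have h1 : x ≠ a := by rintro rfl; exact hx ha
    have h2 : x ≠ b := by rintro rfl; exact hx hb
    have h3 : x ≠ d := by rintro rfl; exact hx hd
    simp [hs, swap_apply_of_ne_of_ne, h1, h2, h3]
  have htc : Commute t c := by
    have h1 : (g * h) * c * (g * h)⁻¹ = c ^ (e * f) := by
      rw [mul_inv_rev, show g * h * c * (h⁻¹ * g⁻¹) = g * (h * c * h⁻¹) * g⁻¹ by group, hhf,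
        ← conj_zpow, hge, zpow_mul]
    have h2 : (h * g) * c * (h * g)⁻¹ = c ^ (e * f) := by
      rw [mul_inv_rev, show h * g * c * (g⁻¹ * h⁻¹) = h * (g * c * g⁻¹) * h⁻¹ by group, hge,
        ← conj_zpow, hhf, ← zpow_mul, mul_comm]
    have h3 := h1.trans h2.symm
    rw [mul_inv_eq_iff_eq_mul] at h3
    rw [Commute, SemiconjBy, show t = (h * g)⁻¹ * (g * h) by rw [ht]; group, mul_assoc, h3]
    group
  set q := c.support.card with hq
  have htq : t ^ q = (s * s) ^ q := by
    have hF : ∀ m : ℕ, ∀ x, c x = x → c ((t ^ m) x) = (t ^ m) x ∧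
        (t ^ m) x = ((s * s) ^ m) x := by
      intro m
      induction m with
      | zero => intro x hx; simpa using hx
      | succ m ih =>
        intro x hx
        obtain ⟨h1, h2⟩ := ih x hx
        rw [pow_succ', pow_succ', Perm.mul_apply t, Perm.mul_apply (s * s), htF _ h1, ← h2]
        exact ⟨hsF _ h1, rfl⟩
    ext x
    by_cases hx : c x = x
    · exact (hF q x hx).2
    have h1 : ((s * s) ^ q) x = x := pow_apply_eq_self_of_apply_eq_self (hsF' x hx) q
    rw [h1]
    have htx : c (t x) ≠ t x := by
      rw [← Perm.mul_apply, ← htc.eq, Perm.mul_apply]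
      exact fun h => hx (t.injective h)
    obtain ⟨i, hi⟩ := hc.exists_zpow_eq hx htx
    have h2 : ∀ m : ℕ, (t ^ m) x = ((c ^ i) ^ m) x := by
      intro m
      induction m with
      | zero => rfl
      | succ m ih =>
        rw [pow_succ, Perm.mul_apply, ← hi, ← Perm.mul_apply,
          ((htc.zpow_right i).pow_left m).eq, Perm.mul_apply, ih, ← Perm.mul_apply, ← pow_succ']
    have hcq : c ^ q = 1 := by rw [hq, ← hc.orderOf, pow_orderOf_eq_one]
    rw [h2, ← zpow_natCast, ← zpow_mul, mul_comm, zpow_mul, zpow_natCast, hcq, one_zpow,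
      Perm.one_apply]
  refine alternatingGroup_le_of_isPreprimitive_of_isThreeCycle_mem hG (g := t ^ q) ?_ ?_
  · have hq3 : q % 3 = 1 ∨ q % 3 = 2 := by
      have : ¬ 3 ∣ q := fun h => h3 ((Nat.prime_dvd_prime_iff_eq Nat.prime_three hp).1 h).symm
      omega
    rw [htq, ← pow_mod_orderOf, hs3.orderOf]
    rcases hq3 with h | h
    · rwa [h, pow_one]
    · rw [h, pow_two]
      exact hs3.isThreeCycle_sq
  · exact pow_mem (mul_mem (mul_mem (mul_mem (inv_mem hgG) (inv_mem hhG)) hgG) hhG) _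

end

section
open Equiv Equiv.Perm
variable {α : Type*} [Fintype α] [DecidableEq α]

theorem Nat.Prime.pow_dvd_or_pow_dvd_of_pow_dvd_lcm {p k a b : ℕ} (hp : p.Prime)
    (h : p ^ k ∣ Nat.lcm a b) : p ^ k ∣ a ∨ p ^ k ∣ b := by
  rcases eq_or_ne a 0 with rfl | ha
  · simp
  rcases eq_or_ne b 0 with rfl | hb
  · simp
  rw [hp.pow_dvd_iff_le_factorization (Nat.lcm_ne_zero ha hb), Nat.factorization_lcm ha hb,
    Finsupp.sup_apply, le_sup_iff] at h
  rwa [hp.pow_dvd_iff_le_factorization ha, hp.pow_dvd_iff_le_factorization hb]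

theorem Multiset.exists_mem_prime_pow_dvd_of_dvd_lcm {p k : ℕ} (hp : p.Prime) (hk : k ≠ 0)
    {s : Multiset ℕ} (h : p ^ k ∣ s.lcm) : ∃ c ∈ s, p ^ k ∣ c := by
  induction s using Multiset.induction_on with
  | empty =>
    rw [Multiset.lcm_zero, Nat.dvd_one] at h
    exact absurd h (Nat.one_lt_pow hk hp.one_lt).ne'
  | cons a s ih =>
    rw [Multiset.lcm_cons] at h
    rcases hp.pow_dvd_or_pow_dvd_of_pow_dvd_lcm h with h | h
    · exact ⟨a, Multiset.mem_cons_self a s, h⟩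
    · obtain ⟨c, hc, hd⟩ := ih h
      exact ⟨c, Multiset.mem_cons_of_mem hc, hd⟩

theorem Equiv.Perm.exists_mem_cycleType_prime_pow_dvd {p k : ℕ} (hp : p.Prime) (hk : k ≠ 0)
    {σ : Perm α} (h : p ^ k ∣ orderOf σ) : ∃ c ∈ σ.cycleType, p ^ k ∣ c :=
  Multiset.exists_mem_prime_pow_dvd_of_dvd_lcm hp hk (by rwa [lcm_cycleType])

theorem exists_mem_alternatingGroup_cycleType_odd {m : ℕ} (hm : Odd m) (h1 : 1 < m)
    (hle : m ≤ Fintype.card α) : ∃ σ ∈ alternatingGroup α, σ.cycleType = {m} := by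
  obtain ⟨σ, hσ⟩ := (exists_with_cycleType_iff α (m := {m})).2 (by simp; omega)
  refine ⟨σ, ?_, hσ⟩
  rw [mem_alternatingGroup, sign_of_cycleType, hσ]
  simp [hm.add_one.neg_one_pow]

theorem exists_mem_alternatingGroup_cycleType_even {m : ℕ} (hm : Even m) (h1 : 1 < m)
    (hle : m + 2 ≤ Fintype.card α) : ∃ σ ∈ alternatingGroup α, σ.cycleType = {m, 2} := by
  obtain ⟨σ, hσ⟩ := (exists_with_cycleType_iff α (m := {m, 2})).2 (by simp; omega)
  refine ⟨σ, ?_, hσ⟩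
  rw [mem_alternatingGroup, sign_of_cycleType, hσ]
  simp
  exact Even.neg_one_pow (by grind)

theorem exists_orderOf_eq_prime_pow_of_dvd_exponent {G : Type*} [Group G] [Finite G]
    {p k : ℕ} (hp : p.Prime) (h : p ^ k ∣ Monoid.exponent G) : ∃ g : G, orderOf g = p ^ k := by
  obtain ⟨g, hg⟩ := hp.exists_orderOf_eq_pow_factorization_exponent G
  have hk := (hp.pow_dvd_iff_le_factorization Monoid.exponent_ne_zero_of_finite).1 h
  refine ⟨g ^ (orderOf g / p ^ k), orderOf_pow_orderOf_div (orderOf_pos g).ne' ?_⟩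
  rw [hg]
  exact pow_dvd_pow p hk

theorem Equiv.Perm.exists_finset_zpow_of_mem_cycleType {σ : Perm α} {m : ℕ} (h : m ∈ σ.cycleType) :
    ∃ S : Finset α, S.card = m ∧ ∀ x ∈ S, ∀ y ∈ S, ∃ i : ℤ, (σ ^ i) x = y := by
  obtain ⟨c, τ, rfl, hd, hc, rfl⟩ := mem_cycleType_iff.1 h
  refine ⟨c.support, rfl, fun x hx y hy => ?_⟩
  obtain ⟨i, rfl⟩ := hc.sameCycle (mem_support.1 hx) (mem_support.1 hy)
  refine ⟨i, ?_⟩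
  have hτ : (τ ^ i) x = x := zpow_apply_eq_self_of_apply_eq_self
    (notMem_support.1 (Finset.disjoint_left.1 hd.disjoint_support hx)) i
  rw [hd.commute.mul_zpow, mul_apply, hτ]

theorem odd_prime_pow_dvd_exponent_alternatingGroup {p r : ℕ} (hp : p.Prime)
    (hodd : Odd p) (hr : r ≠ 0) (hle : p ^ r ≤ Fintype.card α) :
    p ^ r ∣ Monoid.exponent (alternatingGroup α) := by
  obtain ⟨σ, hσ, hc⟩ := exists_mem_alternatingGroup_cycleType_odd hodd.pow
    (Nat.one_lt_pow hr hp.one_lt) hle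
  have := Monoid.order_dvd_exponent (⟨σ, hσ⟩ : alternatingGroup α)
  rw [Subgroup.orderOf_mk, ← lcm_cycleType, hc] at this
  simpa using this

theorem two_pow_dvd_exponent_alternatingGroup {s : ℕ} (hs : s ≠ 0)
    (hle : 2 ^ s + 2 ≤ Fintype.card α) : 2 ^ s ∣ Monoid.exponent (alternatingGroup α) := by
  obtain ⟨σ, hσ, hc⟩ := exists_mem_alternatingGroup_cycleType_even
    ((even_two).pow_of_ne_zero hs) (Nat.one_lt_two_pow hs) hle
  refine dvd_trans ?_ (Monoid.order_dvd_exponent (⟨σ, hσ⟩ : alternatingGroup α))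
  rw [Subgroup.orderOf_mk, ← lcm_cycleType, hc]
  exact Multiset.dvd_lcm (by simp)

end

theorem eq_ten_or_prime_of_two_pow_add_one_eq_prime_pow {k p r : ℕ} (hp : p.Prime) (hodd : Odd p)
    (hr : r ≠ 0) (h : 2 ^ k + 1 = p ^ r) : 2 ^ k + 1 = 9 ∨ (2 ^ k + 1).Prime := by
  rcases eq_or_ne r 1 with rfl | hr1
  · right; rw [h]; simpa using hp
  left
  rcases Nat.even_or_odd' r with ⟨t, rfl | rfl⟩
  · have h2 : (p ^ t - 1) * (p ^ t + 1) = 2 ^ k := by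
      have : 1 ≤ p ^ t := Nat.one_le_pow _ _ hp.pos
      zify [this]
      have : ((2 : ℤ) ^ k + 1) = p ^ (2 * t) := by exact_mod_cast h
      rw [pow_mul'] at this
      linarith
    obtain ⟨a, -, ha⟩ := (Nat.dvd_prime_pow Nat.prime_two).1 (Dvd.intro _ h2)
    obtain ⟨b, -, hb⟩ := (Nat.dvd_prime_pow Nat.prime_two).1 (Dvd.intro_left _ h2)
    have ht : 3 ≤ p ^ t := by
      have : 3 ≤ p := by have := hp.two_le; grind
      exact this.trans (Nat.le_self_pow (by omega) p)
    have hab : 2 ^ a + 2 = 2 ^ b := by omega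
    have ha1 : a = 1 := by
      rcases a with _ | _ | a
      · omega
      · rfl
      rcases b with _ | _ | b
      · omega
      · rw [pow_succ] at hab; omega
      · simp only [pow_succ] at hab; omega
    subst ha1
    have h3 : p ^ t = 3 := by omega
    rw [h, pow_mul', h3]; norm_num
  · exfalso
    have hg := geom_sum_mul_add (p - 1) (2 * t + 1)
    rw [Nat.sub_add_cancel hp.one_le, ← h] at hg
    have hS : (∑ i ∈ Finset.range (2 * t + 1), p ^ i) ∣ 2 ^ k := Dvd.intro (p - 1) (by omega)
    obtain ⟨b, -, hb⟩ := (Nat.dvd_prime_pow Nat.prime_two).1 hS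
    have hoddS : Odd (∑ i ∈ Finset.range (2 * t + 1), p ^ i) := by
      rw [Finset.odd_sum_iff_odd_card_odd]
      rw [Finset.filter_true_of_mem (fun i _ => hodd.pow)]
      simp
    have hb0 : b = 0 := by
      by_contra hb0
      rw [hb, ← Nat.not_even_iff_odd] at hoddS
      exact hoddS (even_two.pow_of_ne_zero hb0)
    have h1 : p ^ 1 < ∑ i ∈ Finset.range (2 * t + 1), p ^ i := by
      rw [Finset.sum_range_succ', pow_zero]
      have : p ^ (0 + 1) ≤ ∑ i ∈ Finset.range (2 * t), p ^ (i + 1) :=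
        Finset.single_le_sum (f := fun i => p ^ (i + 1)) (fun _ _ => Nat.zero_le _) (by simp; omega)
      simp only [zero_add] at this
      omega
    rw [hb, hb0] at h1
    have := hp.two_le
    simp at h1
    omega

section
open MulAction Equiv Equiv.Perm
variable {α : Type*} [Fintype α] [DecidableEq α] {H : Subgroup (alternatingGroup α)}

theorem exists_mem_map_subtype_orderOf_eq_prime_pow {p k : ℕ} (hp : p.Prime)
    (h : p ^ k ∣ Monoid.exponent H) :
    ∃ σ ∈ H.map (alternatingGroup α).subtype, orderOf σ = p ^ k := by
  obtain ⟨g, hg⟩ := exists_orderOf_eq_prime_pow_of_dvd_exponent hp h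
  refine ⟨g.1.1, ⟨g.1, g.2, rfl⟩, ?_⟩
  rw [Subgroup.orderOf_coe, Subgroup.orderOf_coe, hg]

theorem eq_top_of_alternatingGroup_le_map_subtype
    (h : alternatingGroup α ≤ H.map (alternatingGroup α).subtype) : H = ⊤ := by
  rw [eq_top_iff]
  rintro ⟨σ, hσ⟩ -
  obtain ⟨τ, hτ, rfl⟩ := h hσ
  exact hτ

theorem eq_top_of_exponent_eq_of_isPretransitive (hn : 8 ≤ Fintype.card α)
    (h : Monoid.exponent H = Monoid.exponent (alternatingGroup α))
    [IsPretransitive (H.map (alternatingGroup α).subtype) α] : H = ⊤ := by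
  obtain ⟨q, hq, hlt, hle⟩ := exists_prime_lt_and_add_three_le_two_mul
    (n := Fintype.card α / 2) (by omega)
  have hdvd : q ^ 1 ∣ Monoid.exponent H := by
    rw [h]
    exact odd_prime_pow_dvd_exponent_alternatingGroup hq (hq.odd_of_ne_two (by omega)) one_ne_zero
      (by rw [pow_one]; omega)
  obtain ⟨σ, hσ, ho⟩ := exists_mem_map_subtype_orderOf_eq_prime_pow hq hdvd
  rw [pow_one] at ho
  have hc : σ.IsCycle := isCycle_of_prime_order' (by rwa [ho]) (by omega)
  have hs : σ.support.card = q := by rw [← hc.orderOf, ho]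
  exact eq_top_of_alternatingGroup_le_map_subtype <| alternatingGroup_le_of_isCycle_prime
    (isPreprimitive_of_isCycle_prime hc hσ (by rwa [hs]) (by omega)) hc hσ (by rwa [hs])
    (by omega)

theorem isPretransitive_map_subtype_of_exponent_eq_of_prime_pow {p r : ℕ}
    (hp : p.Prime) (hodd : Odd p) (hr : r ≠ 0) (hn : Fintype.card α = p ^ r)
    (h : Monoid.exponent H = Monoid.exponent (alternatingGroup α)) :
    IsPretransitive (H.map (alternatingGroup α).subtype) α := by
  obtain ⟨σ, hσ, ho⟩ := exists_mem_map_subtype_orderOf_eq_prime_pow hp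
    (h ▸ odd_prime_pow_dvd_exponent_alternatingGroup hp hodd hr hn.ge)
  obtain ⟨c, hc, hd⟩ := exists_mem_cycleType_prime_pow_dvd hp hr ho.symm.dvd
  obtain ⟨S, rfl, hS⟩ := exists_finset_zpow_of_mem_cycleType hc
  have hS' : S = Finset.univ := by
    rw [← Finset.card_eq_iff_eq_univ]
    refine le_antisymm (Finset.card_le_univ S) (hn ▸ Nat.le_of_dvd ?_ hd)
    have := two_le_of_mem_cycleType hc
    omega
  refine ⟨fun x y => ?_⟩
  obtain ⟨i, hi⟩ := hS x (by simp [hS']) y (by simp [hS'])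
  exact ⟨⟨σ ^ i, zpow_mem hσ i⟩, hi⟩

theorem apply_ne_self_of_two_pow_dvd_orderOf {k : ℕ} (hk : k ≠ 0) (hn : Fintype.card α = 2 ^ k + 2)
    {σ : Perm α} (hσ : σ ∈ alternatingGroup α) (ho : 2 ^ k ∣ orderOf σ) (x : α) : σ x ≠ x := by
  intro hx
  obtain ⟨c, hc, hd⟩ := exists_mem_cycleType_prime_pow_dvd Nat.prime_two hk ho
  have hsum : σ.cycleType.sum ≤ 2 ^ k + 1 := by
    rw [sum_cycleType]
    have : σ.support ⊆ Finset.univ.erase x := fun y hy =>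
      Finset.mem_erase.2 ⟨fun hxy => mem_support.1 hy (hxy ▸ hx), Finset.mem_univ y⟩
    have := Finset.card_le_card this
    rw [Finset.card_erase_of_mem (Finset.mem_univ x), Finset.card_univ] at this
    omega
  obtain ⟨t, ht⟩ := Multiset.exists_cons_of_mem hc
  have hc0 := two_le_of_mem_cycleType hc
  have h2 : 2 ≤ 2 ^ k := Nat.le_self_pow hk 2
  have hle := Nat.le_of_dvd (by omega) hd
  rw [ht, Multiset.sum_cons] at hsum
  have ht0 : t = 0 := by
    rw [Multiset.eq_zero_iff_forall_notMem]
    intro a ha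
    have h3 := two_le_of_mem_cycleType (σ := σ) (ht ▸ Multiset.mem_cons_of_mem ha)
    have h4 := Multiset.single_le_sum (fun _ _ => Nat.zero_le _) a ha
    omega
  have hck : c = 2 ^ k := by
    obtain ⟨m, rfl⟩ := hd
    have : m < 2 := by
      by_contra! hm
      have := Nat.mul_le_mul_left (2 ^ k) hm
      omega
    interval_cases m <;> omega
  rw [mem_alternatingGroup, sign_of_cycleType, ht, ht0, hck] at hσ
  have hodd : Odd (2 ^ k + 1) := (even_two.pow_of_ne_zero hk).add_one
  simp [hodd.neg_one_pow] at hσ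

theorem isPretransitive_map_subtype_of_exponent_eq_of_two_pow_add_two {k p r : ℕ} (hk : k ≠ 0)
    (hp : p.Prime) (hodd : Odd p) (hr : r ≠ 0)
    (hn : Fintype.card α = 2 ^ k + 2) (hpr : 2 ^ k + 1 = p ^ r)
    (h : Monoid.exponent H = Monoid.exponent (alternatingGroup α)) :
    IsPretransitive (H.map (alternatingGroup α).subtype) α := by
  obtain ⟨σ, hσ, ho⟩ := exists_mem_map_subtype_orderOf_eq_prime_pow hp
    (h ▸ odd_prime_pow_dvd_exponent_alternatingGroup hp hodd hr (by omega))
  obtain ⟨τ, hτ, hτo⟩ := exists_mem_map_subtype_orderOf_eq_prime_pow Nat.prime_two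
    (h ▸ two_pow_dvd_exponent_alternatingGroup hk hn.ge)
  have hτ' : ∀ x, τ x ≠ x := apply_ne_self_of_two_pow_dvd_orderOf hk hn
    (Subgroup.map_subtype_le _ hτ) hτo.symm.dvd
  obtain ⟨c, hc, hd⟩ := exists_mem_cycleType_prime_pow_dvd hp hr ho.symm.dvd
  obtain ⟨S, rfl, hS⟩ := exists_finset_zpow_of_mem_cycleType hc
  have hle : 2 ^ k + 1 ≤ S.card := by
    have := two_le_of_mem_cycleType hc
    exact hpr ▸ Nat.le_of_dvd (by omega) hd
  have huniq : ∀ x ∉ S, ∀ y ∉ S, x = y := by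
    have : Sᶜ.card ≤ 1 := by rw [Finset.card_compl]; omega
    intro x hx y hy
    exact Finset.card_le_one.1 this x (by simpa) y (by simpa)
  set G := H.map (alternatingGroup α).subtype
  have hrel : ∀ x, ∃ g ∈ G, g x ∈ S := by
    intro x
    by_cases hx : x ∈ S
    · exact ⟨1, one_mem _, hx⟩
    · exact ⟨τ, hτ, by_contra fun h' => hτ' x (huniq _ h' _ hx)⟩
  refine ⟨fun x y => ?_⟩
  obtain ⟨g, hg, hgx⟩ := hrel x
  obtain ⟨g', hg', hgy⟩ := hrel y
  obtain ⟨i, hi⟩ := hS _ hgx _ hgy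
  refine ⟨⟨g'⁻¹ * (σ ^ i * g), mul_mem (inv_mem hg') (mul_mem (zpow_mem hσ i) hg)⟩, ?_⟩
  rw [Subgroup.smul_def, Perm.smul_def]
  simp [hi]
end

section
open Equiv Equiv.Perm

theorem Subgroup.card_dvd_factorial_index {G : Type*} [Group G] [Finite G] [IsSimpleGroup G]
    {H : Subgroup G} (hH : H ≠ ⊤) : Nat.card G ∣ H.index.factorial := by
  have hcore : H.normalCore = ⊥ := (H.normalCore_normal.eq_bot_or_eq_top).resolve_right
    fun h => hH (top_le_iff.1 (h ▸ H.normalCore_le))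
  rw [← Subgroup.index_bot, ← hcore, H.normalCore_eq_ker, Subgroup.index_ker, H.index_eq_card,
    ← Nat.card_perm]
  exact Subgroup.card_subgroup_dvd_card _

theorem Group.exists_orderOf_eq_fifteen_of_card_eq_fifteen {G : Type*} [Group G] [Finite G]
    (h : Nat.card G = 15) : ∃ g : G, orderOf g = 15 := by
  have : Fact (Nat.Prime 3) := ⟨Nat.prime_three⟩
  have : Fact (Nat.Prime 5) := ⟨Nat.prime_five⟩
  obtain ⟨a, ha⟩ := exists_prime_orderOf_dvd_card' (G := G) 3 (by rw [h]; norm_num)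
  obtain ⟨b, hb⟩ := exists_prime_orderOf_dvd_card' (G := G) 5 (by rw [h]; norm_num)
  have hcard : Nat.card (Subgroup.zpowers a) = 3 ^ (Nat.card G).factorization 3 := by
    rw [Nat.card_zpowers, ha, h]
    have : (15 : ℕ).factorization 3 = 1 := by
      rw [show (15 : ℕ) = 3 ^ 1 * 5 by norm_num, Nat.factorization_mul (by norm_num) (by norm_num),
        Nat.Prime.factorization_pow Nat.prime_three]
      simp [Nat.factorization_eq_zero_of_not_dvd]
    rw [this, pow_one]
  let P : Sylow 3 G := Sylow.ofCard (Subgroup.zpowers a) hcard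
  have hP : (P : Subgroup G) = Subgroup.zpowers a := rfl
  have hcyc : IsCyclic P := by rw [hP]; infer_instance
  have hone : Nat.card (Sylow 3 G) = 1 := by
    have h1 := card_sylow_modEq_one 3 G
    have h2 := P.card_dvd_index
    have hidx : (P : Subgroup G).index = 5 := by
      have := (P : Subgroup G).card_mul_index
      rw [hP, Nat.card_zpowers, ha, h] at this
      rw [hP]; omega
    rw [hidx, Nat.dvd_prime Nat.prime_five] at h2
    rcases h2 with h2 | h2
    · exact h2
    · rw [h2] at h1; exact absurd h1 (by decide)
  have := (Nat.card_eq_one_iff_unique.1 hone).1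
  have hnorm : (P : Subgroup G).Normal := inferInstance
  have hcent : Subgroup.normalizer ((P : Subgroup G) : Set G) ≤ Subgroup.centralizer (P : Set G) :=
    hcyc.normalizer_le_centralizer (P := P) (by rw [h]; norm_num)
  rw [Subgroup.normalizer_eq_top] at hcent
  have hab : Commute a b :=
    Subgroup.mem_centralizer_iff.1 (hcent (Subgroup.mem_top b)) a (Subgroup.mem_zpowers a)
  exact ⟨a * b, by rw [hab.orderOf_mul_eq_mul_orderOf_of_coprime (by rw [ha, hb]; norm_num),
    ha, hb]⟩

theorem Group.exists_orderOf_eq_fifteen_of_card_eq_sixty {G : Type*} [Group G] [Finite G]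
    (h : Nat.card G = 60) {g : G} (hg : orderOf g = 4) : ∃ g : G, orderOf g = 15 := by
  have : Fact (Nat.Prime 2) := ⟨Nat.prime_two⟩
  have hcard : Nat.card (Subgroup.zpowers g) = 2 ^ (Nat.card G).factorization 2 := by
    rw [Nat.card_zpowers, hg, h]
    have : (60 : ℕ).factorization 2 = 2 := by
      rw [show (60 : ℕ) = 2 ^ 2 * 15 by norm_num, Nat.factorization_mul (by norm_num) (by norm_num),
        Nat.Prime.factorization_pow Nat.prime_two]
      simp [Nat.factorization_eq_zero_of_not_dvd]
    rw [this]
    norm_num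
  let P : Sylow 2 G := Sylow.ofCard (Subgroup.zpowers g) hcard
  have hP : (P : Subgroup G) = Subgroup.zpowers g := rfl
  have hcyc : IsCyclic P := by rw [hP]; infer_instance
  have hcompl := hcyc.isComplement' (P := P) (by rw [h]; norm_num)
  have hmul := hcompl.card_mul_card.trans h
  rw [show Nat.card P = 4 from (Nat.card_zpowers g).trans hg] at hmul
  obtain ⟨x, hx⟩ := Group.exists_orderOf_eq_fifteen_of_card_eq_fifteen
    (by omega : Nat.card (MonoidHom.transferSylow P _).ker = 15)
  exact ⟨x, by rw [Subgroup.orderOf_coe, hx]⟩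

theorem Equiv.Perm.orderOf_ne_fifteen {α : Type*} [Fintype α] [DecidableEq α]
    (h : Fintype.card α < 8) (σ : Perm α) : orderOf σ ≠ 15 := by
  intro ho
  obtain ⟨a, ha, hda⟩ := exists_mem_cycleType_prime_pow_dvd (σ := σ) Nat.prime_three one_ne_zero
    (by rw [ho]; norm_num)
  obtain ⟨b, hb, hdb⟩ := exists_mem_cycleType_prime_pow_dvd (σ := σ) Nat.prime_five one_ne_zero
    (by rw [ho]; norm_num)
  have hsum : σ.cycleType.sum < 8 := σ.sum_cycleType_le.trans_lt h
  have hb2 := two_le_of_mem_cycleType hb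
  have ha2 := two_le_of_mem_cycleType ha
  obtain ⟨t, ht⟩ := Multiset.exists_cons_of_mem ha
  rw [ht, Multiset.sum_cons] at hsum
  rw [ht, Multiset.mem_cons] at hb
  rcases hb with rfl | hb
  · omega
  · have := Multiset.single_le_sum (fun _ _ => Nat.zero_le _) b hb
    omega

variable {α : Type*} [Fintype α] [DecidableEq α] {H : Subgroup (alternatingGroup α)}

/-- Numerical constraints on a proper subgroup of full exponent, using the simplicity of `A_n`. -/
theorem card_constraints_of_exponent_eq (hn : 5 ≤ Fintype.card α) (hH : H ≠ ⊤)
    (h : Monoid.exponent H = Monoid.exponent (alternatingGroup α)) :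
    Nat.card H * H.index = (Fintype.card α).factorial / 2 ∧
      (Fintype.card α).factorial / 2 ∣ H.index.factorial ∧
      Monoid.exponent (alternatingGroup α) ∣ Nat.card H := by
  have : Nontrivial α := Fintype.one_lt_card_iff_nontrivial.1 (by omega)
  have := alternatingGroup.isSimpleGroup (α := α) (by rwa [Nat.card_eq_fintype_card])
  have hcard := nat_card_alternatingGroup (α := α)
  rw [Nat.card_eq_fintype_card (α := α)] at hcard
  exact ⟨hcard ▸ H.card_mul_index, hcard ▸ Subgroup.card_dvd_factorial_index hH,
    h ▸ Group.exponent_dvd_nat_card⟩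

theorem eq_top_of_exponent_eq_of_card_eq_five (hn : Fintype.card α = 5)
    (h : Monoid.exponent H = Monoid.exponent (alternatingGroup α)) : H = ⊤ := by
  by_contra hH
  obtain ⟨hmul, hdvd, hexp⟩ := card_constraints_of_exponent_eq (by omega) hH h
  have h5 := (odd_prime_pow_dvd_exponent_alternatingGroup (α := α) (r := 1) Nat.prime_five
    (by decide) (by norm_num) (by omega)).trans hexp
  have h3 := (odd_prime_pow_dvd_exponent_alternatingGroup (α := α) (r := 1) Nat.prime_three
    (by decide) (by norm_num) (by omega)).trans hexp
  have h2 := (two_pow_dvd_exponent_alternatingGroup (α := α) (s := 1)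
    (by norm_num) (by omega)).trans hexp
  rw [hn, show Nat.factorial 5 / 2 = 60 by simp [Nat.factorial]] at hdvd hmul
  obtain ⟨m, hm⟩ : 30 ∣ Nat.card H := by omega
  have : H.index ∣ 2 := ⟨m, by rw [hm] at hmul; linarith⟩
  have := (Nat.dvd_prime Nat.prime_two).1 this
  rcases this with h' | h' <;> rw [h'] at hdvd <;> exact absurd hdvd (by decide)

theorem eq_top_of_exponent_eq_of_card_eq_seven (hn : Fintype.card α = 7)
    (h : Monoid.exponent H = Monoid.exponent (alternatingGroup α)) : H = ⊤ := by
  by_contra hH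
  obtain ⟨hmul, hdvd, hexp⟩ := card_constraints_of_exponent_eq (by omega) hH h
  have h7 := (odd_prime_pow_dvd_exponent_alternatingGroup (α := α) (r := 1) Nat.prime_seven
    (by decide) (by norm_num) (by omega)).trans hexp
  have h5 := (odd_prime_pow_dvd_exponent_alternatingGroup (α := α) (r := 1) Nat.prime_five
    (by decide) (by norm_num) (by omega)).trans hexp
  have h3 := (odd_prime_pow_dvd_exponent_alternatingGroup (α := α) (r := 1) Nat.prime_three
    (by decide) (by norm_num) (by omega)).trans hexp
  have h2 := (two_pow_dvd_exponent_alternatingGroup (α := α) (s := 2)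
    (by norm_num) (by omega)).trans hexp
  rw [hn, show Nat.factorial 7 / 2 = 2520 by simp [Nat.factorial]] at hdvd hmul
  have h60 : 60 ∣ Nat.card H := by clear h7; omega
  obtain ⟨m, hm⟩ : 60 * 7 ^ 1 ∣ Nat.card H :=
    Nat.Coprime.mul_dvd_of_dvd_of_dvd (by norm_num) h60 h7
  have : H.index ∣ 6 := ⟨m, by rw [hm] at hmul; linarith⟩
  have h6 := Nat.factorial_dvd_factorial (Nat.le_of_dvd (by norm_num) this)
  exact absurd (hdvd.trans h6) (by simp [Nat.factorial])

theorem eq_top_of_exponent_eq_of_card_eq_six (hn : Fintype.card α = 6)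
    (h : Monoid.exponent H = Monoid.exponent (alternatingGroup α)) : H = ⊤ := by
  by_contra hH
  obtain ⟨hmul, hdvd, hexp⟩ := card_constraints_of_exponent_eq (by omega) hH h
  have h5 := (odd_prime_pow_dvd_exponent_alternatingGroup (α := α) (r := 1) Nat.prime_five
    (by decide) (by norm_num) (by omega)).trans hexp
  have h3 := (odd_prime_pow_dvd_exponent_alternatingGroup (α := α) (r := 1) Nat.prime_three
    (by decide) (by norm_num) (by omega)).trans hexp
  have h2' := two_pow_dvd_exponent_alternatingGroup (α := α) (s := 2)
    (by norm_num) (by omega)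
  have h2 := h2'.trans hexp
  rw [hn, show Nat.factorial 6 / 2 = 360 by simp [Nat.factorial]] at hdvd hmul
  obtain ⟨m, hm⟩ : 60 ∣ Nat.card H := by omega
  have h6 : H.index ∣ 6 := ⟨m, by rw [hm] at hmul; linarith⟩
  have hle := Nat.le_of_dvd (by norm_num) h6
  have hidx : H.index = 6 := by
    by_contra hne
    have : H.index ≤ 5 := by omega
    exact absurd (hdvd.trans (Nat.factorial_dvd_factorial this)) (by simp [Nat.factorial])
  obtain ⟨g, hg⟩ := exists_orderOf_eq_prime_pow_of_dvd_exponent Nat.prime_two (h ▸ h2')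
  obtain ⟨x, hx⟩ := Group.exists_orderOf_eq_fifteen_of_card_eq_sixty
    (by rw [hidx] at hmul; omega) hg
  refine orderOf_ne_fifteen (by omega) x.1.1 ?_
  rw [Subgroup.orderOf_coe, Subgroup.orderOf_coe, hx]
end

section
open MulAction Equiv Equiv.Perm
variable {α : Type*} [Fintype α] [DecidableEq α] {K : Subgroup (Perm α)}

theorem Equiv.Perm.two_pow_add_two_le_of_dvd_mem_cycleType {σ : Perm α}
    (hσ : σ ∈ alternatingGroup α) {s c : ℕ} (hs : s ≠ 0) (hc : c ∈ σ.cycleType) (hd : 2 ^ s ∣ c) :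
    2 ^ s + 2 ≤ Fintype.card α := by
  obtain ⟨t, ht⟩ := Multiset.exists_cons_of_mem hc
  have hc0 := two_le_of_mem_cycleType hc
  have hle := Nat.le_of_dvd (by omega) hd
  have hsum : σ.cycleType.sum ≤ Fintype.card α := σ.sum_cycleType_le
  rw [ht, Multiset.sum_cons] at hsum
  rcases t.empty_or_exists_mem with rfl | ⟨a, ha⟩
  · rw [mem_alternatingGroup, sign_of_cycleType, ht] at hσ
    have hodd : Odd (c + 1) := (even_iff_two_dvd.2 ((dvd_pow_self 2 hs).trans hd)).add_one
    simp [hodd.neg_one_pow] at hσ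
  · have h3 := two_le_of_mem_cycleType (σ := σ) (ht ▸ Multiset.mem_cons_of_mem ha)
    have h4 := Multiset.single_le_sum (fun _ _ => Nat.zero_le _) a ha
    omega

/-- A subgroup meeting, up to conjugacy, every cycle of odd prime power length and every product of
a cycle of length `2 ^ s` with a disjoint transposition has full exponent in `A_n`. -/
theorem exponent_subgroupOf_alternatingGroup_eq
    (h1 : ∀ p r : ℕ, p.Prime → Odd p → r ≠ 0 → ∀ σ : Perm α, σ.cycleType = {p ^ r} →
      ∃ g, g * σ * g⁻¹ ∈ K)
    (h2 : ∀ s : ℕ, s ≠ 0 → ∀ σ : Perm α, σ.cycleType = {2 ^ s, 2} → ∃ g, g * σ * g⁻¹ ∈ K) :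
    Monoid.exponent (K.subgroupOf (alternatingGroup α)) =
      Monoid.exponent (alternatingGroup α) := by
  have key : ∀ (m : ℕ) (σ : Perm α), σ ∈ alternatingGroup α → m ∈ σ.cycleType →
      (∃ g, g * σ * g⁻¹ ∈ K) → m ∣ Monoid.exponent (K.subgroupOf (alternatingGroup α)) := by
    rintro m σ hσ hm ⟨g, hg⟩
    have hA : g * σ * g⁻¹ ∈ alternatingGroup α := (alternatingGroup.normal).conj_mem σ hσ g
    have := Monoid.order_dvd_exponent
      (⟨⟨_, hA⟩, Subgroup.mem_subgroupOf.2 hg⟩ : K.subgroupOf (alternatingGroup α))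
    rw [Subgroup.orderOf_mk, Subgroup.orderOf_mk, ← lcm_cycleType, cycleType_conj] at this
    exact (Multiset.dvd_lcm hm).trans this
  refine dvd_antisymm
    (Monoid.exponent_dvd_of_monoidHom _ (Subgroup.subtype_injective _)) ?_
  rw [Monoid.exponent_dvd]
  rintro ⟨σ, hσ⟩
  rw [Subgroup.orderOf_mk, Nat.dvd_iff_prime_pow_dvd_dvd]
  intro p k hp hd
  rcases eq_or_ne k 0 with rfl | hk
  · simp
  obtain ⟨c, hc, hdc⟩ := exists_mem_cycleType_prime_pow_dvd hp hk hd
  rcases hp.eq_two_or_odd' with rfl | hodd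
  · have hle := two_pow_add_two_le_of_dvd_mem_cycleType hσ hk hc hdc
    obtain ⟨τ, hτ, hct⟩ := exists_mem_alternatingGroup_cycleType_even
      (even_two.pow_of_ne_zero hk) (Nat.one_lt_two_pow hk) hle
    exact key _ τ hτ (by simp [hct]) (h2 k hk τ hct)
  · have hle : p ^ k ≤ Fintype.card α := by
      have h0 := two_le_of_mem_cycleType hc
      have := Nat.le_of_dvd (by omega) hdc
      exact this.trans ((Multiset.single_le_sum (fun _ _ => Nat.zero_le _) c hc).trans
        σ.sum_cycleType_le)
    obtain ⟨τ, hτ, hct⟩ := exists_mem_alternatingGroup_cycleType_odd hodd.pow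
      (Nat.one_lt_pow hk hp.one_lt) hle
    exact key _ τ hτ (by simp [hct]) (h1 p k hp hodd hk τ hct)

theorem exists_conj_mem_stabilizer {σ : Perm α} (h : σ.cycleType.sum < Fintype.card α) (a : α) :
    ∃ g, g * σ * g⁻¹ ∈ stabilizer (Perm α) a := by
  rw [sum_cycleType, Finset.card_lt_iff_ne_univ, Ne, Finset.eq_univ_iff_forall] at h
  push Not at h
  obtain ⟨x, hx⟩ := h
  exact ⟨swap x a, by simp [mem_stabilizer_iff, notMem_support.1 hx]⟩

theorem exists_conj_mem_centralizer_swap {β : Type*} [DecidableEq β] {σ : Perm β}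
    {a b x y : β} (hab : a ≠ b) (hxy : x ≠ y)
    (h : Commute (swap x y) σ) : ∃ g, g * σ * g⁻¹ ∈ Subgroup.centralizer {swap a b} := by
  obtain ⟨g, hg⟩ := isConj_iff.1 (isConj_swap hxy hab)
  refine ⟨g, ?_⟩
  rw [Subgroup.mem_centralizer_singleton_iff, ← hg]
  have := h.eq
  simp only [mul_assoc, inv_mul_cancel_left]
  rw [← mul_assoc σ, ← this, mul_assoc]

theorem exists_commute_swap_of_sum_cycleType_add_two_le {σ : Perm α}
    (h : σ.cycleType.sum + 2 ≤ Fintype.card α) : ∃ x y, x ≠ y ∧ Commute (swap x y) σ := by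
  rw [sum_cycleType] at h
  have : 1 < σ.supportᶜ.card := by rw [Finset.card_compl]; omega
  obtain ⟨x, hx, y, hy, hxy⟩ := Finset.one_lt_card.1 this
  refine ⟨x, y, hxy, Disjoint.commute ?_⟩
  rw [disjoint_iff_disjoint_support, support_swap hxy]
  simp_all

theorem exists_commute_swap_of_two_mem_cycleType {σ : Perm α} (h : 2 ∈ σ.cycleType) :
    ∃ x y, x ≠ y ∧ Commute (swap x y) σ := by
  obtain ⟨c, τ, rfl, hd, -, hc⟩ := mem_cycleType_iff.1 h
  obtain ⟨x, y, hxy, rfl⟩ := card_support_eq_two.1 hc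
  exact ⟨x, y, hxy, (Commute.refl _).mul_right hd.commute⟩

theorem exists_mem_alternatingGroup_apply_eq_and_apply_eq (h : 4 ≤ Fintype.card α)
    {a b : α} (hab : a ≠ b) :
    ∃ g ∈ alternatingGroup α, g a ≠ a ∧ g a ≠ b ∧ g b = b := by
  have : 1 < (({a, b} : Finset α)ᶜ).card := by
    rw [Finset.card_compl, Finset.card_pair hab]; omega
  obtain ⟨c, hc, d, hd, hcd⟩ := Finset.one_lt_card.1 this
  simp only [Finset.mem_compl, Finset.mem_insert, Finset.mem_singleton, not_or] at hc hd
  refine ⟨swap a c * swap c d, ?_, ?_⟩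
  · simp [mem_alternatingGroup, sign_swap hcd, sign_swap (Ne.symm hc.1)]
  · have h1 : swap c d a = a := swap_apply_of_ne_of_ne (Ne.symm hc.1) (Ne.symm hd.1)
    have h2 : swap c d b = b := swap_apply_of_ne_of_ne (Ne.symm hc.2) (Ne.symm hd.2)
    have h3 : swap a c b = b := swap_apply_of_ne_of_ne hab.symm (Ne.symm hc.2)
    simp [h1, h2, h3, hc.1, hc.2]

theorem stabilizer_subgroupOf_alternatingGroup_ne_top (h : 4 ≤ Fintype.card α) (a : α) :
    (stabilizer (Perm α) a).subgroupOf (alternatingGroup α) ≠ ⊤ := by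
  have : Nontrivial α := Fintype.one_lt_card_iff_nontrivial.1 (by omega)
  obtain ⟨b, hb⟩ := exists_ne a
  obtain ⟨g, hg, hga, -⟩ := exists_mem_alternatingGroup_apply_eq_and_apply_eq h hb.symm
  rw [Ne, Subgroup.subgroupOf_eq_top]
  exact fun hle => hga (mem_stabilizer_iff.1 (hle hg))

theorem centralizer_swap_subgroupOf_alternatingGroup_ne_top (h : 4 ≤ Fintype.card α)
    {a b : α} (hab : a ≠ b) :
    (Subgroup.centralizer {swap a b}).subgroupOf (alternatingGroup α) ≠ ⊤ := by
  obtain ⟨g, hg, hga, hgb, hb⟩ := exists_mem_alternatingGroup_apply_eq_and_apply_eq h hab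
  rw [Ne, Subgroup.subgroupOf_eq_top]
  intro hle
  have := DFunLike.congr_fun (Subgroup.mem_centralizer_singleton_iff.1 (hle hg)) b
  simp [hb, hga] at this
end

/-- The alternating group `A_n` (`n ≥ 5`) contains a proper subgroup with the same
exponent iff `n` is not `10`, not a power `p^r` of an odd prime, and not `p_f + 1`
for a Fermat prime `p_f`. -/
theorem alternating_exists_proper_subgroup_same_exponent_iff (n : ℕ) (hn : 5 ≤ n) :
    (∃ H : Subgroup (alternatingGroup (Fin n)), H ≠ ⊤ ∧
        Monoid.exponent H = Monoid.exponent (alternatingGroup (Fin n))) ↔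
      ¬ (n = 10 ∨ (∃ p r : ℕ, p.Prime ∧ Odd p ∧ 1 ≤ r ∧ n = p ^ r) ∨
          (∃ p : ℕ, p.Prime ∧ (∃ k : ℕ, p = 2 ^ 2 ^ k + 1) ∧ n = p + 1)) := by
  have hcard := Fintype.card_fin n
  constructor
  · rintro ⟨H, hH, h⟩ hlist
    refine hH ?_
    obtain rfl | hn5 := eq_or_ne n 5
    · exact eq_top_of_exponent_eq_of_card_eq_five hcard h
    obtain rfl | hn6 := eq_or_ne n 6
    · exact eq_top_of_exponent_eq_of_card_eq_six hcard h
    obtain rfl | hn7 := eq_or_ne n 7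
    · exact eq_top_of_exponent_eq_of_card_eq_seven hcard h
    have htrans : MulAction.IsPretransitive (H.map (alternatingGroup (Fin n)).subtype) (Fin n) := by
      rcases hlist with rfl | ⟨p, r, hp, hodd, hr, rfl⟩ | ⟨p, hp, ⟨k, rfl⟩, rfl⟩
      · exact isPretransitive_map_subtype_of_exponent_eq_of_two_pow_add_two (k := 3) (p := 3)
          (r := 2) (by norm_num) Nat.prime_three (by decide) (by norm_num) hcard (by norm_num) h
      · exact isPretransitive_map_subtype_of_exponent_eq_of_prime_pow hp hodd (by omega) hcard h
      · exact isPretransitive_map_subtype_of_exponent_eq_of_two_pow_add_two (k := 2 ^ k) (r := 1)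
          (by positivity) hp (even_two.pow_of_ne_zero (by positivity)).add_one one_ne_zero hcard
          (pow_one _).symm h
    exact eq_top_of_exponent_eq_of_isPretransitive (by omega) h
  · intro hlist
    simp only [not_or, not_exists, not_and] at hlist
    obtain ⟨h10, hpow, hfermat⟩ := hlist
    have hpow' : ∀ p r : ℕ, p.Prime → Odd p → r ≠ 0 → n ≠ p ^ r :=
      fun p r hp hodd hr => hpow p r hp hodd (Nat.one_le_iff_ne_zero.2 hr)
    by_cases hk : ∃ k, n = 2 ^ k + 2
    · obtain ⟨k, hk⟩ := hk
      have hk0 : k ≠ 0 := by rintro rfl; omega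
      have hne : ∀ p r : ℕ, p.Prime → Odd p → r ≠ 0 → 2 ^ k + 1 ≠ p ^ r := by
        intro p r hp hodd hr heq
        rcases eq_ten_or_prime_of_two_pow_add_one_eq_prime_pow hp hodd hr heq with h9 | hprime
        · omega
        · obtain ⟨m, rfl⟩ := Nat.pow_of_pow_add_prime one_lt_two hk0 hprime
          exact hfermat _ hprime ⟨m, rfl⟩ (by omega)
      have hab : (⟨0, by omega⟩ : Fin n) ≠ ⟨1, by omega⟩ := by simp
      refine ⟨_, centralizer_swap_subgroupOf_alternatingGroup_ne_top (by omega) hab,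
        exponent_subgroupOf_alternatingGroup_eq ?_ ?_⟩
      · intro p r hp hodd hr σ hσ
        have hle : p ^ r ≤ n := by simpa [hσ] using σ.sum_cycleType_le
        have h1 := hpow' p r hp hodd hr
        have h2 := hne p r hp hodd hr
        obtain ⟨x, y, hxy, hc⟩ := exists_commute_swap_of_sum_cycleType_add_two_le (σ := σ)
          (by rw [hσ, Multiset.sum_singleton, hcard]; omega)
        exact exists_conj_mem_centralizer_swap hab hxy hc
      · intro s _ σ hσ
        obtain ⟨x, y, hxy, hc⟩ := exists_commute_swap_of_two_mem_cycleType (σ := σ) (by simp [hσ])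
        exact exists_conj_mem_centralizer_swap hab hxy hc
    · push Not at hk
      refine ⟨_, stabilizer_subgroupOf_alternatingGroup_ne_top (by omega) ⟨0, by omega⟩,
        exponent_subgroupOf_alternatingGroup_eq ?_ ?_⟩
      · intro p r hp hodd hr σ hσ
        have hle := σ.sum_cycleType_le
        refine exists_conj_mem_stabilizer (lt_of_le_of_ne hle ?_) _
        rw [hσ, Multiset.sum_singleton, hcard]
        exact (hpow' p r hp hodd hr).symm
      · intro s _ σ hσ
        have hle := σ.sum_cycleType_le
        refine exists_conj_mem_stabilizer (lt_of_le_of_ne hle ?_) _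
        rw [hσ, hcard]
        simpa using (hk s).symm
end

section
/- Let n ≥ 5 with n = p^r for some odd prime p and r ≥ 1. Then every proper subgroup H of the alternating group A_n satisfies exp(H) ≠ exp(A_n). -/
namespace Nat

/-- If the only prime in `(n, 2 * n]` is possibly `2 * n - 1`, then the central binomial coefficient
satisfies the same upper bound as when there is no prime in that interval. -/
theorem centralBinom_le_of_no_prime_le_two_mul_sub_two (n : ℕ) (n_large : 2 < n)
    (no_prime : ∀ p : ℕ, p.Prime → n < p → 2 * n - 2 < p) :
    centralBinom n ≤ (2 * n) ^ sqrt (2 * n) * 4 ^ (2 * n / 3) := by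
  have n2_pos : 1 ≤ 2 * n := by omega
  let f x := x ^ n.centralBinom.factorization x
  let S := {p ∈ Finset.range (2 * n / 3 + 1) | Nat.Prime p}
  have hS : centralBinom n = ∏ p ∈ insert (2 * n - 1) S, f p := by
    refine (Eq.trans ?_ n.prod_pow_factorization_centralBinom).symm
    apply Finset.prod_subset
    · intro x hx
      simp only [S, Finset.mem_insert, Finset.mem_filter, Finset.mem_range] at hx ⊢
      omega
    · intro x hx h2x
      simp only [S, Finset.mem_insert, Finset.mem_filter, Finset.mem_range, not_or, not_and] at hx h2x
      by_cases hp : x.Prime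
      · have hxn : x ≤ n := by
          by_contra h
          have := no_prime x hp (by omega)
          have h2 : x = 2 * n := by omega
          have := (Nat.prime_dvd_prime_iff_eq Nat.prime_two hp).1 ⟨n, h2⟩
          omega
        have h3 : ¬ x < 2 * n / 3 + 1 := fun h => h2x.2 h hp
        simp only [f]
        rw [factorization_centralBinom_of_two_mul_self_lt_three_mul n_large hxn (by omega),
          Nat.pow_zero]
      · simp only [f]
        rw [factorization_eq_zero_of_not_prime n.centralBinom hp, Nat.pow_zero]
  have hnot : 2 * n - 1 ∉ S := by
    simp only [S, Finset.mem_filter, Finset.mem_range]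
    omega
  rw [hS, Finset.prod_insert hnot, ← Finset.prod_filter_mul_prod_filter_not S (· ≤ sqrt (2 * n)),
    ← mul_assoc]
  have hs1 : 1 ≤ sqrt (2 * n) := Nat.le_sqrt.2 (by omega)
  apply mul_le_mul'
  · have hpow : (2 * n) ^ sqrt (2 * n) = 2 * n * (2 * n) ^ (sqrt (2 * n) - 1) := by
      rw [← _root_.pow_succ', Nat.sub_add_cancel hs1]
    rw [hpow]
    apply mul_le_mul' (pow_factorization_choose_le n2_pos)
    refine (Finset.prod_le_prod' fun p _ => (?_ : f p ≤ 2 * n)).trans ?_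
    · exact pow_factorization_choose_le n2_pos
    have : (Finset.Icc 2 (sqrt (2 * n))).card = sqrt (2 * n) - 1 := by rw [card_Icc]; omega
    rw [Finset.prod_const]
    refine pow_right_mono₀ n2_pos ((Finset.card_le_card fun x hx => ?_).trans this.le)
    obtain ⟨h1, h2⟩ := Finset.mem_filter.1 hx
    exact Finset.mem_Icc.mpr ⟨(Finset.mem_filter.1 h1).2.two_le, h2⟩
  · refine le_trans ?_ (primorial_le_four_pow (2 * n / 3))
    refine (Finset.prod_le_prod' fun p hp => (?_ : f p ≤ p)).trans ?_
    · obtain ⟨h1, h2⟩ := Finset.mem_filter.1 hp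
      refine (pow_right_mono₀ (Finset.mem_filter.1 h1).2.one_lt.le ?_).trans (pow_one p).le
      exact Nat.factorization_choose_le_one (sqrt_lt'.mp <| not_le.1 h2)
    refine Finset.prod_le_prod_of_subset_of_one_le' (Finset.filter_subset _ _) ?_
    exact fun p hp _ => (Finset.mem_filter.1 hp).2.one_lt.le

/-- A strengthening of **Bertrand's postulate**: for `4 ≤ n` there is a prime `p` such that
`n < p ≤ 2 * n - 2`. -/
theorem exists_prime_lt_and_le_two_mul_sub_two (n : ℕ) (hn : 4 ≤ n) :
    ∃ p, Nat.Prime p ∧ n < p ∧ p ≤ 2 * n - 2 := by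
  rcases lt_or_ge n 512 with h | h
  · have step (q p : ℕ) (hp : p.Prime) (hpq : p ≤ 2 * q - 2)
        (H : n < q → ∃ p, Nat.Prime p ∧ n < p ∧ p ≤ 2 * n - 2) (hnp : n < p) :
        ∃ p, Nat.Prime p ∧ n < p ∧ p ≤ 2 * n - 2 := by
      rcases lt_or_ge n q with hq | hq
      · exact H hq
      · exact ⟨p, hp, hnp, by omega⟩
    have hn521 : n < 521 := by omega
    revert hn521
    refine step 317 521 (by norm_num1) (by norm_num1) ?_
    refine step 163 317 (by norm_num1) (by norm_num1) ?_
    refine step 83 163 (by norm_num1) (by norm_num1) ?_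
    refine step 43 83 (by norm_num1) (by norm_num1) ?_
    refine step 23 43 (by norm_num1) (by norm_num1) ?_
    refine step 13 23 (by norm_num1) (by norm_num1) ?_
    refine step 11 13 (by norm_num1) (by norm_num1) ?_
    refine step 7 11 (by norm_num1) (by norm_num1) ?_
    refine step 5 7 (by norm_num1) (by norm_num1) ?_
    exact fun h5 => ⟨5, by norm_num1, h5, by omega⟩
  · have no_prime : 4 ^ n < n * n.centralBinom := Nat.four_pow_lt_mul_centralBinom n hn
    contrapose! no_prime
    have := centralBinom_le_of_no_prime_le_two_mul_sub_two n (by omega) no_prime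
    grw [this, ← mul_assoc, bertrand_main_inequality h]

end Nat

open MulAction Equiv
open scoped Pointwise

/-- If `q ^ 2` does not divide the order of a finite group, then any two elements of prime order `q`
generate conjugate subgroups. -/
theorem exists_conj_mem_zpowers_of_orderOf_eq_prime {K : Type*} [Group K] [Finite K] {q : ℕ}
    (hq : q.Prime) (hK : ¬ q ^ 2 ∣ Nat.card K) {a b : K} (ha : orderOf a = q)
    (hb : orderOf b = q) : ∃ k : K, k * a * k⁻¹ ∈ Subgroup.zpowers b := by
  have : Fact q.Prime := ⟨hq⟩
  have hfac : (Nat.card K).factorization q = 1 := by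
    have h0 : Nat.card K ≠ 0 := Nat.card_pos.ne'
    have h1 := (hq.dvd_iff_one_le_factorization h0).1 (ha ▸ orderOf_dvd_natCard a)
    have h2 := mt (hq.pow_dvd_iff_le_factorization h0).2 hK
    omega
  obtain ⟨k, hk⟩ := exists_smul_eq K
    (Sylow.ofCard (Subgroup.zpowers a) (by rw [Nat.card_zpowers, hfac, pow_one, ha]))
    (Sylow.ofCard (Subgroup.zpowers b) (by rw [Nat.card_zpowers, hfac, pow_one, hb]))
  refine ⟨k, ?_⟩
  have hmem : k * a * k⁻¹ ∈ MulAut.conj k • Subgroup.zpowers a :=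
    Subgroup.smul_mem_pointwise_smul a (MulAut.conj k) _ (Subgroup.mem_zpowers a)
  have hk' : MulAut.conj k • Subgroup.zpowers a = Subgroup.zpowers b :=
    congrArg (fun P : Sylow q K => (P : Subgroup K)) hk
  rwa [hk'] at hmem

namespace Equiv.Perm

theorem card_fixingSubgroup {α : Type*} [Finite α] (s : Set α) :
    Nat.card (fixingSubgroup (Perm α) s) = (Nat.card α - s.ncard).factorial := by
  have h1 := IsMultiplyPretransitive.index_of_fixingSubgroup_mul (G := Perm α) (α := α)
    (Perm.isMultiplyPretransitive α s.ncard) (s := s) rfl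
  have h2 := (fixingSubgroup (Perm α) s).index_mul_card
  rw [Nat.card_perm, ← h1] at h2
  exact Nat.eq_of_mul_eq_mul_left (Nat.pos_of_ne_zero Subgroup.index_ne_zero_of_finite) h2

variable {α : Type*} [Fintype α] [DecidableEq α] {G : Subgroup (Perm α)} {g : Perm α}

/-- In a primitive permutation group, a cycle of prime length that fixes at least one point makes
the group transitive on tuples of as many points as the cycle fixes. -/
theorem isMultiplyPretransitive_of_isPreprimitive_of_isCycle_mem (hG : IsPreprimitive G α)
    (hgc : g.IsCycle) (hg : g ∈ G) (hq : g.support.card.Prime)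
    (hn : g.support.card < Fintype.card α) :
    IsMultiplyPretransitive G α (Fintype.card α - g.support.card) := by
  set s : Set α := (g.support : Set α)ᶜ with hs
  have hcard : s.ncard = Fintype.card α - g.support.card := by
    rw [hs, Set.ncard_compl, Set.ncard_coe_finset, Nat.card_eq_fintype_card]
  have := isPretransitive_of_isCycle_mem hgc hg
  have hprim : IsPreprimitive (fixingSubgroup G s) (SubMulAction.ofFixingSubgroup G s) := by
    apply IsPreprimitive.of_prime_card
    rw [show Nat.card (SubMulAction.ofFixingSubgroup G s) = g.support.card from ?_]
    · exact hq
    · change Set.ncard (sᶜ) = _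
      rw [hs, compl_compl, Set.ncard_coe_finset]
  have h2 := hq.two_le
  have := (hG.isMultiplyPreprimitive (s := s) (n := Fintype.card α - g.support.card - 1)
    (by omega) (by rw [Nat.card_eq_fintype_card]; omega) hprim).isMultiplyPretransitive
  exact isMultiplyPretransitive_of_le' (G := G) (α := α)
    (n := Fintype.card α - g.support.card - 1 + 2) (by omega) (by
      rw [ENat.card_eq_coe_fintype_card]; norm_cast; omega)

/-- Every permutation of the points fixed by a cycle of prime length is induced by an element
of the group that normalizes the subgroup generated by the cycle, as soon as the group is
sufficiently transitive. -/
theorem exists_mem_conj_mem_zpowers_of_isCycle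
    (hG : IsMultiplyPretransitive G α (Fintype.card α - g.support.card))
    (hgc : g.IsCycle) (hg : g ∈ G) (hq : g.support.card.Prime)
    (σ : Perm α) (hσ : ∀ x, x ∉ g.support → σ x ∉ g.support) :
    ∃ h ∈ G, (∀ x, x ∉ g.support → h x = σ x) ∧ h * g * h⁻¹ ∈ Subgroup.zpowers g := by
  set s : Set α := (g.support : Set α)ᶜ with hs
  have hcard : s.ncard = Fintype.card α - g.support.card := by
    rw [hs, Set.ncard_compl, Set.ncard_coe_finset, Nat.card_eq_fintype_card]
  have hcard' : Fintype.card (g.supportᶜ : Finset α) = Fintype.card α - g.support.card := by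
    rw [Fintype.card_coe, Finset.card_compl]
  let e : Fin (Fintype.card α - g.support.card) ≃ (g.supportᶜ : Finset α) :=
    (Fintype.equivFinOfCardEq hcard').symm
  let u : Fin (Fintype.card α - g.support.card) ↪ α :=
    e.toEmbedding.trans (Function.Embedding.subtype _)
  obtain ⟨⟨h, hh⟩, hhu⟩ := hG.exists_smul_eq u (u.trans σ.toEmbedding)
  have hhσ : ∀ x, x ∉ g.support → h x = σ x := by
    intro x hx
    have := DFunLike.congr_fun hhu (e.symm ⟨x, by simpa using hx⟩)
    simpa [u, Subgroup.smul_def] using this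
  let K : Subgroup (Perm α) := G ⊓ fixingSubgroup (Perm α) s
  have hmemK : ∀ k, k ∈ K ↔ k ∈ G ∧ ∀ x, x ∉ g.support → k x = x := by
    intro k
    simp [K, Subgroup.mem_inf, mem_fixingSubgroup_iff, hs]
  have hKcard : ¬ g.support.card ^ 2 ∣ Nat.card K := by
    intro hdvd
    have h1 : Nat.card K ∣ Nat.card (fixingSubgroup (Perm α) s) :=
      Subgroup.card_dvd_of_le inf_le_right
    have hle : g.support.card ≤ Fintype.card α := Finset.card_le_univ _
    rw [card_fixingSubgroup, hcard, Nat.card_eq_fintype_card (α := α), Nat.sub_sub_self hle] at h1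
    have h2 := hdvd.trans h1
    rw [← Nat.mul_factorial_pred hq.ne_zero, pow_two] at h2
    have h3 := Nat.dvd_of_mul_dvd_mul_left hq.pos h2
    have := (hq.dvd_factorial).1 h3
    have := hq.pos
    omega
  have hgK : g ∈ K := (hmemK g).2 ⟨hg, fun x hx => notMem_support.1 hx⟩
  have hcK : h * g * h⁻¹ ∈ K := by
    refine (hmemK _).2 ⟨G.mul_mem (G.mul_mem hh hg) (G.inv_mem hh), fun x hx => ?_⟩
    have hmaps : ∀ y ∈ g.supportᶜ, h y ∈ g.supportᶜ := fun y hy => by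
      rw [Finset.mem_compl] at hy ⊢
      rw [hhσ y hy]; exact hσ y hy
    obtain ⟨y, hy, rfl⟩ := Finset.surj_on_of_inj_on_of_card_le (s := g.supportᶜ) (t := g.supportᶜ)
      (fun y _ => h y) hmaps (fun _ _ _ _ h' => h.injective h') le_rfl x (by simpa using hx)
    rw [Perm.mul_apply, Perm.mul_apply, Perm.inv_def, Equiv.symm_apply_apply,
      notMem_support.1 (Finset.mem_compl.1 hy)]
  obtain ⟨⟨k, hk⟩, hkmem⟩ := exists_conj_mem_zpowers_of_orderOf_eq_prime (K := K) hq hKcard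
    (a := ⟨h * g * h⁻¹, hcK⟩) (b := ⟨g, hgK⟩)
    (by rw [Subgroup.orderOf_mk, ← MulAut.conj_apply, MulEquiv.orderOf_eq, hgc.orderOf])
    (by rw [Subgroup.orderOf_mk, hgc.orderOf])
  obtain ⟨hkG, hkfix⟩ := (hmemK k).1 hk
  refine ⟨k * h, G.mul_mem hkG hh, fun x hx => ?_, ?_⟩
  · rw [Perm.mul_apply, hhσ x hx, hkfix _ (hσ x hx)]
  · obtain ⟨i, hi⟩ := Subgroup.mem_zpowers_iff.1 hkmem
    refine Subgroup.mem_zpowers_iff.2 ⟨i, ?_⟩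
    have := congrArg Subtype.val hi
    simp only [Subgroup.coe_zpow, Subgroup.coe_mul, Subgroup.coe_inv] at this
    rw [this]; group

/-- **Jordan's theorem on prime cycles**: a primitive permutation group containing a cycle of prime
length that fixes at least three points contains the alternating group. -/
theorem alternatingGroup_le_of_isPreprimitive_of_isCycle_mem (hG : IsPreprimitive G α)
    (hgc : g.IsCycle) (hg : g ∈ G) (hq : g.support.card.Prime)
    (hn : g.support.card + 3 ≤ Fintype.card α) : alternatingGroup α ≤ G := by
  have hGt := isMultiplyPretransitive_of_isPreprimitive_of_isCycle_mem hG hgc hg hq (by omega)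
  have hcard : 2 < (g.supportᶜ).card := by rw [Finset.card_compl]; omega
  obtain ⟨a, ha, b, hb, c, hc, hab, hac, hbc⟩ := Finset.two_lt_card.1 hcard
  rw [Finset.mem_compl] at ha hb hc
  have hswap : ∀ u v, u ∉ g.support → v ∉ g.support → ∀ x, x ∉ g.support →
      swap u v x ∉ g.support := by
    intro u v hu hv x hx
    rw [swap_apply_def]
    split_ifs <;> assumption
  obtain ⟨x, hxG, hx, hxg⟩ := exists_mem_conj_mem_zpowers_of_isCycle hGt hgc hg hq
    (swap a b) (hswap a b ha hb)
  obtain ⟨y, hyG, hy, hyg⟩ := exists_mem_conj_mem_zpowers_of_isCycle hGt hgc hg hq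
    (swap a c) (hswap a c ha hc)
  obtain ⟨i, hi⟩ := Subgroup.mem_zpowers_iff.1 hxg
  obtain ⟨j, hj⟩ := Subgroup.mem_zpowers_iff.1 hyg
  let d := (y * x)⁻¹ * (x * y)
  have hdG : d ∈ G := G.mul_mem (G.inv_mem (G.mul_mem hyG hxG)) (G.mul_mem hxG hyG)
  have hxy : (x * y) * g * (x * y)⁻¹ = g ^ (i * j) := by
    calc (x * y) * g * (x * y)⁻¹ = x * (y * g * y⁻¹) * x⁻¹ := by group
      _ = g ^ (i * j) := by rw [← hj, ← conj_zpow, ← hi, zpow_mul]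
  have hyx : (y * x) * g * (y * x)⁻¹ = g ^ (i * j) := by
    calc (y * x) * g * (y * x)⁻¹ = y * (x * g * x⁻¹) * y⁻¹ := by group
      _ = g ^ (i * j) := by rw [← hi, ← conj_zpow, ← hj, ← zpow_mul, mul_comm]
  have hd : Commute d g := by
    have : (y * x)⁻¹ * ((x * y) * g * (x * y)⁻¹) * (y * x) = g := by
      rw [hxy, ← hyx]; group
    rw [Commute, SemiconjBy]
    conv_rhs => rw [← this]
    simp only [d]; group
  have hdswap : ∀ z, z ∉ g.support → d z = (swap a b * swap a c * (swap a b * swap a c)) z := by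
    intro z hz
    have h1 := hswap a b ha hb
    have h2 := hswap a c ha hc
    have h3 : (x * y) z = (swap a b * swap a c) z := by
      rw [Perm.mul_apply, Perm.mul_apply, hy z hz, hx _ (h2 z hz)]
    have h4 : (y * x) ((swap a b * swap a c * (swap a b * swap a c)) z)
        = (swap a b * swap a c) z := by
      simp only [Perm.mul_apply]
      rw [hx _ (h1 _ (h2 _ (h1 _ (h2 _ hz)))), swap_apply_self, hy _ (h2 _ (h1 _ (h2 _ hz))),
        swap_apply_self]
    simp only [d]
    rw [Perm.mul_apply, h3, ← h4, Perm.inv_def, Equiv.symm_apply_apply]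
  obtain ⟨z₀, hz₀, hcyc⟩ := hgc
  have hdz₀ : g (d z₀) ≠ d z₀ := by
    intro h
    rw [← Perm.mul_apply, ← hd.eq, Perm.mul_apply] at h
    exact hz₀ (d.injective h)
  obtain ⟨m, hm⟩ := hcyc hdz₀
  have hfix : ∀ z ∈ g.support, (g ^ (-m) * d) z = z := by
    intro z hz
    obtain ⟨l, rfl⟩ := hcyc (mem_support.1 hz)
    have hcomm : Commute (g ^ (-m) * d) (g ^ l) :=
      (Commute.zpow_zpow_self g _ _).mul_left (hd.zpow_right l)
    rw [← Perm.mul_apply, hcomm.eq, Perm.mul_apply, Perm.mul_apply, ← hm, zpow_neg,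
      Perm.inv_def, Equiv.symm_apply_apply]
  have hthree : g ^ (-m) * d = swap a b * swap a c * (swap a b * swap a c) := by
    ext z
    by_cases hz : z ∈ g.support
    · have hza : z ≠ a := fun h => ha (h ▸ hz)
      have hzb : z ≠ b := fun h => hb (h ▸ hz)
      have hzc : z ≠ c := fun h => hc (h ▸ hz)
      rw [hfix z hz]
      simp [swap_apply_of_ne_of_ne, hza, hzb, hzc]
    · have hz' : (swap a b * swap a c * (swap a b * swap a c)) z ∉ g.support :=
        hswap a b ha hb _ (hswap a c ha hc _ (hswap a b ha hb _ (hswap a c ha hc _ hz)))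
      rw [Perm.mul_apply, hdswap z hz]
      exact zpow_apply_eq_self_of_apply_eq_self (notMem_support.1 hz') _
  refine alternatingGroup_le_of_isPreprimitive_of_isThreeCycle_mem hG
    (isThreeCycle_swap_mul_swap_same hab hac hbc).isThreeCycle_sq ?_
  rw [← hthree]
  exact G.mul_mem (G.zpow_mem hg _) hdG

end Equiv.Perm

namespace Equiv.Perm

variable {α : Type*} [Fintype α] [DecidableEq α] {G : Subgroup (Perm α)} {g : Perm α}

/-- A transitive permutation group containing a cycle of prime length that moves more than half of
the points is primitive. -/
theorem isPreprimitive_of_isCycle_mem [IsPretransitive G α] (hgc : g.IsCycle) (hg : g ∈ G)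
    (hq : g.support.card.Prime) (hlt : Fintype.card α < 2 * g.support.card) :
    IsPreprimitive G α := by
  obtain ⟨a, ha, hcyc⟩ := hgc
  have hgc : g.IsCycle := ⟨a, ha, hcyc⟩
  refine IsPreprimitive.of_isTrivialBlock_base a fun {B} haB hB => ?_
  by_cases hgB : (⟨g, hg⟩ : G) • B = B
  · right
    apply hB.eq_univ_of_card_lt
    rw [Nat.card_eq_fintype_card]
    have hsub : (g.support : Set α) ⊆ B := by
      intro x hx
      obtain ⟨i, rfl⟩ := hcyc (mem_support.1 hx)
      have h : (⟨g, hg⟩ : G) ^ i ∈ stabilizer G B := Subgroup.zpow_mem _ hgB i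
      have h' := Set.smul_mem_smul_set (a := (⟨g, hg⟩ : G) ^ i) haB
      rw [mem_stabilizer_iff.1 h] at h'
      simpa [Subgroup.smul_def] using h'
    have := Set.ncard_le_ncard hsub
    rw [Set.ncard_coe_finset] at this
    omega
  · left
    have hmoved : ∀ x ∈ B, g x ≠ x := by
      intro x hx hgx
      refine hgB (hB.smul_eq_of_mem (g := ⟨g, hg⟩) hx ?_)
      rwa [Subgroup.smul_def, Perm.smul_def, hgx]
    have hbase : ∀ x ∈ B, x = a := by
      intro x hx
      by_contra hxa
      obtain ⟨i, hi⟩ := hcyc (hmoved x hx)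
      have hst : (⟨g, hg⟩ : G) ^ i ∈ stabilizer G B := by
        refine hB.smul_eq_of_mem haB ?_
        simpa [Subgroup.smul_def, hi] using hx
      have hcop : IsCoprime i (g.support.card : ℤ) := by
        refine ((Nat.prime_iff_prime_int.1 hq).coprime_iff_not_dvd.2 fun hdvd => hxa ?_).symm
        rw [← hgc.orderOf, orderOf_dvd_iff_zpow_eq_one] at hdvd
        rw [← hi, hdvd, Perm.one_apply]
      obtain ⟨u, v, huv⟩ := hcop
      have hgu : (⟨g, hg⟩ : G) = ((⟨g, hg⟩ : G) ^ i) ^ u := by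
        apply Subtype.ext
        have h1 : g ^ (v * (g.support.card : ℤ)) = 1 := by
          rw [← hgc.orderOf, ← orderOf_dvd_iff_zpow_eq_one]
          exact dvd_mul_left _ _
        calc g = g ^ (u * i + v * (g.support.card : ℤ)) := by rw [huv, zpow_one]
          _ = (g ^ i) ^ u := by rw [zpow_add, h1, mul_one, mul_comm, zpow_mul]
      apply hgB
      rw [hgu]
      exact Subgroup.zpow_mem _ hst u
    exact fun x hx y hy => (hbase x hx).trans (hbase y hy).symm

/-- A permutation of a set of prime power cardinality whose order is that cardinality acts
transitively. -/
theorem isPretransitive_of_orderOf_eq_prime_pow {p k : ℕ} (hp : p.Prime)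
    (hcard : Fintype.card α = p ^ (k + 1)) (horder : orderOf g = p ^ (k + 1)) (hg : g ∈ G) :
    IsPretransitive G α := by
  have : Fact p.Prime := ⟨hp⟩
  obtain ⟨x, hx⟩ : ∃ x, (g ^ p ^ k) x ≠ x := by
    by_contra! h
    have h1 : g ^ p ^ k = 1 := Perm.ext h
    have h2 := Nat.le_of_dvd (pow_pos hp.pos k) (orderOf_dvd_of_pow_eq_one h1)
    rw [horder] at h2
    exact absurd h2 (not_le.2 (Nat.pow_lt_pow_right hp.one_lt (Nat.lt_succ_self k)))
  have hper : Function.minimalPeriod g x = p ^ (k + 1) := by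
    apply Function.minimalPeriod_eq_prime_pow
    · rwa [Function.IsPeriodicPt, Function.IsFixedPt, ← Perm.coe_pow]
    · rw [Function.IsPeriodicPt, Function.IsFixedPt, ← Perm.coe_pow, ← horder, pow_orderOf_eq_one,
        Perm.one_apply]
  have horbit : ∀ y, ∃ h ∈ G, h x = y := by
    have hinj : Function.Injective fun i : Fin (p ^ (k + 1)) => (g ^ (i : ℕ)) x := by
      intro i j hij
      simp only [Perm.coe_pow] at hij
      exact Fin.ext (Function.iterate_injOn_Iio_minimalPeriod (f := g) (x := x)
        (by simp [hper]) (by simp [hper]) hij)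
    have hsurj := ((Fintype.bijective_iff_injective_and_card _).2 ⟨hinj, by simp [hcard]⟩).2
    intro y
    obtain ⟨i, hi⟩ := hsurj y
    exact ⟨g ^ (i : ℕ), G.pow_mem hg _, hi⟩
  refine (isPretransitive_iff_base x).2 fun y => ?_
  obtain ⟨h, hh, hy⟩ := horbit y
  exact ⟨⟨h, hh⟩, hy⟩

end Equiv.Perm

/-- If a prime power is the order of an element of some finite group, it is the order of an element
of every finite group with the same exponent. -/
theorem Monoid.exists_orderOf_eq_prime_pow_of_exponent_eq {G K : Type*} [Group G] [Group K]
    [Finite K] (h : Monoid.exponent G = Monoid.exponent K) {q k : ℕ} (hq : q.Prime) {x : K}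
    (hx : orderOf x = q ^ k) : ∃ y : G, orderOf y = q ^ k := by
  have hle : k ≤ (Monoid.exponent G).factorization q := by
    rw [h, ← hq.pow_dvd_iff_le_factorization Monoid.exponent_ne_zero_of_finite, ← hx]
    exact Monoid.order_dvd_exponent x
  obtain ⟨y, hy⟩ := hq.exists_orderOf_eq_pow_factorization_exponent G
  refine ⟨y ^ q ^ ((Monoid.exponent G).factorization q - k), ?_⟩
  rw [orderOf_pow_of_dvd (pow_ne_zero _ hq.ne_zero) (hy ▸ pow_dvd_pow q (Nat.sub_le _ _)), hy,
    Nat.pow_div (Nat.sub_le _ _) hq.pos, Nat.sub_sub_self hle]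

/-- A proper subgroup `H` of a finite simple group `G` satisfies `|G| ≤ [G : H]!`. -/
theorem Subgroup.card_le_index_factorial_of_isSimpleGroup {G : Type*} [Group G] [Finite G]
    [IsSimpleGroup G] {H : Subgroup G} (hH : H ≠ ⊤) : Nat.card G ≤ H.index.factorial := by
  have hcore : H.normalCore = ⊥ := by
    refine (Subgroup.Normal.eq_bot_or_eq_top inferInstance).resolve_right fun h => hH ?_
    exact top_le_iff.1 (h ▸ H.normalCore_le)
  rw [Subgroup.normalCore_eq_ker, MonoidHom.ker_eq_bot_iff] at hcore
  exact (Nat.card_le_card_of_injective _ hcore).trans_eq (by rw [Nat.card_perm, Subgroup.index])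

namespace alternatingGroup

variable {α : Type*} [Fintype α] [DecidableEq α]

theorem prime_dvd_card {q : ℕ} (hq : q.Prime) (hodd : q ≠ 2) (hle : q ≤ Fintype.card α) :
    q ∣ Nat.card (alternatingGroup α) := by
  have : Nontrivial α := Fintype.one_lt_card_iff_nontrivial.1 (hq.one_lt.trans_le hle)
  have h : q ∣ 2 * Nat.card (alternatingGroup α) := by
    rw [two_mul_nat_card_alternatingGroup, Nat.card_perm, Nat.card_eq_fintype_card]
    exact hq.dvd_factorial.2 hle
  exact ((Nat.coprime_primes hq Nat.prime_two).2 hodd).dvd_of_dvd_mul_left h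

/-- A subgroup of `A_7` with the same exponent is all of `A_7`. -/
theorem eq_top_of_exponent_eq_of_card_eq_seven {H : Subgroup (alternatingGroup (Fin 7))}
    (h : Monoid.exponent H = Monoid.exponent (alternatingGroup (Fin 7))) : H = ⊤ := by
  have hdvd : ∀ {q k : ℕ} (_ : q.Prime) {x : alternatingGroup (Fin 7)} (_ : orderOf x = q ^ k),
      q ^ k ∣ Nat.card H := by
    intro q k hq x hx
    obtain ⟨y, hy⟩ := Monoid.exists_orderOf_eq_prime_pow_of_exponent_eq h hq hx
    exact hy ▸ orderOf_dvd_natCard y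
  have hodd : ∀ q : ℕ, q.Prime → q ≠ 2 → q ≤ 7 → q ∣ Nat.card H := by
    intro q hq h2 hle
    have : Fact q.Prime := ⟨hq⟩
    obtain ⟨x, hx⟩ := exists_prime_orderOf_dvd_card' q
      (prime_dvd_card (α := Fin 7) hq h2 (by simpa using hle))
    simpa using hdvd (k := 1) hq (x := x) (by rw [hx, pow_one])
  have h4 : 2 ^ 2 ∣ Nat.card H := by
    let f : Equiv.Perm (Fin 7) := swap 0 1 * swap 1 2 * swap 2 3 * swap 4 5
    have hf : f ∈ alternatingGroup (Fin 7) := by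
      rw [Equiv.Perm.mem_alternatingGroup]; decide
    have : Fact (Nat.Prime 2) := ⟨Nat.prime_two⟩
    refine hdvd Nat.prime_two (x := ⟨f, hf⟩) ?_
    rw [Subgroup.orderOf_mk]
    exact orderOf_eq_prime_pow (by decide) (by decide)
  have h420 : 420 ∣ Nat.card H := by
    have h3 := hodd 3 (by norm_num) (by norm_num) (by norm_num)
    have h5 := hodd 5 (by norm_num) (by norm_num) (by norm_num)
    have h7 := hodd 7 (by norm_num) (by norm_num) (by norm_num)
    omega
  have hcard : Nat.card (alternatingGroup (Fin 7)) = 2520 := by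
    rw [nat_card_alternatingGroup, Nat.card_eq_fintype_card, Fintype.card_fin]; rfl
  by_contra hH
  have : IsSimpleGroup (alternatingGroup (Fin 7)) := alternatingGroup.isSimpleGroup (by simp)
  have hle := Subgroup.card_le_index_factorial_of_isSimpleGroup hH
  have hmul := H.card_mul_index
  have h420' := Nat.le_of_dvd Nat.card_pos h420
  have hindex : H.index ≤ 6 := by nlinarith
  have := Nat.factorial_le hindex
  rw [hcard] at hle
  have h6 : Nat.factorial 6 = 720 := rfl
  omega

/-- An odd prime power `n ≥ 5` other than `7` admits a prime `q > n / 2` such that a cycle of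
length `q` either is a `3`-cycle or fixes at least three of `n` points. -/
theorem exists_prime_of_odd {n : ℕ} (hn : 5 ≤ n) (hodd : Odd n) (h7 : n ≠ 7) :
    ∃ q, q.Prime ∧ q ≠ 2 ∧ n < 2 * q ∧ q ≤ n ∧ (q = 3 ∨ q + 3 ≤ n) := by
  obtain ⟨m, rfl⟩ := hodd
  rcases lt_or_ge m 4 with hm | hm
  · exact ⟨3, Nat.prime_three, by omega⟩
  · obtain ⟨q, hq, h1, h2⟩ := Nat.exists_prime_lt_and_le_two_mul_sub_two m hm
    exact ⟨q, hq, by omega⟩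

end alternatingGroup

/-- If `n ≥ 5` is a power of an odd prime, then no proper subgroup of the alternating
group `A_n` has the same exponent as `A_n`. -/
theorem alternatingGroup_no_proper_subgroup_same_exponent_of_odd_prime_pow
    (n p r : ℕ) (hn : 5 ≤ n) (hp : p.Prime) (hodd : Odd p) (hr : 1 ≤ r)
    (hnpr : n = p ^ r) :
    ∀ H : Subgroup (alternatingGroup (Fin n)), H ≠ ⊤ →
      Monoid.exponent H ≠ Monoid.exponent (alternatingGroup (Fin n)) := by
  intro H hH hexp
  by_cases h7 : n = 7
  · subst h7
    exact hH (alternatingGroup.eq_top_of_exponent_eq_of_card_eq_seven hexp)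
  have hn_odd : Odd n := hnpr ▸ hodd.pow
  let G : Subgroup (Perm (Fin n)) := H.map (alternatingGroup (Fin n)).subtype
  have hmem : ∀ y : H, ((y : alternatingGroup (Fin n)) : Perm (Fin n)) ∈ G := fun y =>
    Subgroup.mem_map_of_mem _ y.2
  have horder : ∀ {q k : ℕ} (_ : q.Prime) {x : alternatingGroup (Fin n)} (_ : orderOf x = q ^ k),
      ∃ g ∈ G, orderOf g = q ^ k := by
    intro q k hq x hx
    obtain ⟨y, hy⟩ := Monoid.exists_orderOf_eq_prime_pow_of_exponent_eq hexp hq hx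
    exact ⟨y, hmem y, by rw [Subgroup.orderOf_coe, Subgroup.orderOf_coe, hy]⟩
  obtain ⟨k, rfl⟩ : ∃ k, r = k + 1 := ⟨r - 1, by omega⟩
  have hrot : finRotate n ∈ alternatingGroup (Fin n) := by
    rw [Equiv.Perm.mem_alternatingGroup, sign_finRotate]
    exact (hn_odd.tsub_odd odd_one).neg_one_pow
  have hrot_order : orderOf (finRotate n) = p ^ (k + 1) := by
    obtain ⟨m, rfl⟩ : ∃ m, n = m + 2 := ⟨n - 2, by omega⟩
    rw [isCycle_finRotate.orderOf, support_finRotate, Finset.card_univ, Fintype.card_fin, hnpr]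
  obtain ⟨c, hcG, hc⟩ := horder hp (x := ⟨finRotate n, hrot⟩)
    (by rw [Subgroup.orderOf_mk, hrot_order])
  have := Perm.isPretransitive_of_orderOf_eq_prime_pow hp (by rw [Fintype.card_fin, hnpr]) hc hcG
  obtain ⟨q, hq, hq2, hlt, hle, hq3⟩ := alternatingGroup.exists_prime_of_odd hn hn_odd h7
  have : Fact q.Prime := ⟨hq⟩
  obtain ⟨x, hx⟩ := exists_prime_orderOf_dvd_card' q
    (alternatingGroup.prime_dvd_card (α := Fin n) hq hq2 (by simpa using hle))
  obtain ⟨g, hgG, hg⟩ := horder (k := 1) hq (x := x) (by rw [hx, pow_one])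
  rw [pow_one] at hg
  have hgc : g.IsCycle := by
    apply Perm.isCycle_of_prime_order (hg ▸ hq)
    have := Finset.card_le_univ g.support
    rw [Fintype.card_fin] at this
    omega
  have hsupp : g.support.card = q := by rw [← hgc.orderOf, hg]
  have hprim : IsPreprimitive G (Fin n) := Perm.isPreprimitive_of_isCycle_mem hgc hgG
    (hsupp ▸ hq) (by rw [hsupp, Fintype.card_fin]; exact hlt)
  have hAG : alternatingGroup (Fin n) ≤ G := by
    rcases hq3 with h3 | h3
    · exact Perm.alternatingGroup_le_of_isPreprimitive_of_isThreeCycle_mem hprim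
        (card_support_eq_three_iff.1 (hsupp.trans h3)) hgG
    · exact Perm.alternatingGroup_le_of_isPreprimitive_of_isCycle_mem hprim hgc hgG (hsupp ▸ hq)
        (by rw [hsupp, Fintype.card_fin]; exact h3)
  refine hH ((Subgroup.eq_top_iff' H).2 fun x => ?_)
  obtain ⟨y, hy, hyx⟩ := hAG x.2
  rwa [← Subtype.ext hyx]
end

section
/- Let p be an odd prime and q a prime power with p not dividing q. Let e = ord_p(q) be the multiplicative order of q modulo p and suppose e is odd. Let r be such that p^r exactly divides q^e − 1, and let v, n be natural numbers with 2e·p^v ≤ 2n < 2e·p^(v+1). Then exp_p(Sp_{2n}(F_q)) = p^(r+v). -/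
open Polynomial in
/-- A matrix of prime power order over an algebraically closed field in which the prime is
invertible has an eigenvalue of the same order. -/
theorem Matrix.exists_isRoot_charpoly_orderOf_eq {ι K : Type*} [Fintype ι] [DecidableEq ι]
    [Field K] [IsAlgClosed K] {p k : ℕ} (hp : p.Prime) (hpK : (p : K) ≠ 0)
    {A : Matrix ι ι K} (hA : orderOf A = p ^ (k + 1)) :
    ∃ ζ : K, A.charpoly.IsRoot ζ ∧ orderOf ζ = p ^ (k + 1) := by
  have : Fact p.Prime := ⟨hp⟩
  have hint : IsIntegral K A := Algebra.IsIntegral.isIntegral A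
  have hmul : minpoly K A ∣ X ^ p ^ (k + 1) - 1 := by
    apply minpoly.dvd
    simp [← hA, pow_orderOf_eq_one]
  have hsep : (minpoly K A).Separable := by
    refine Separable.of_dvd ?_ hmul
    exact (X_pow_sub_one_separable_iff).2 (by simpa using hpK)
  by_contra! hcon
  have hroots : ∀ x ∈ (minpoly K A).roots, x ^ p ^ k = 1 := by
    intro x hx
    have hx' := isRoot_of_mem_roots hx
    by_contra hne
    refine hcon x (hx'.dvd A.minpoly_dvd_charpoly) (orderOf_eq_prime_pow hne ?_)
    have := hx'.dvd hmul
    simpa [sub_eq_zero] using this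
  have hdvd : minpoly K A ∣ X ^ p ^ k - 1 := by
    have hne : (X ^ p ^ k - 1 : K[X]) ≠ 0 := X_pow_sub_C_ne_zero (pow_pos hp.pos k) 1
    refine (IsAlgClosed.splits _).dvd_of_roots_le_roots (minpoly.ne_zero hint) ?_
    rw [Multiset.le_iff_subset (nodup_roots hsep)]
    intro x hx
    rw [mem_roots hne]
    simp [hroots x hx]
  have h1 : A ^ p ^ k = 1 := by
    simpa [sub_eq_zero] using (minpoly.dvd_iff).1 hdvd
  have := Nat.le_of_dvd (pow_pos hp.pos k) (hA ▸ orderOf_dvd_of_pow_eq_one h1)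
  exact absurd this (not_le.2 (Nat.pow_lt_pow_right hp.one_lt (Nat.lt_succ_self k)))

/-- The eigenvalues of a symplectic matrix are closed under inversion. -/
theorem SymplecticGroup.isRoot_charpoly_inv {ι K : Type*} [Fintype ι] [DecidableEq ι] [Field K]
    {A : Matrix (ι ⊕ ι) (ι ⊕ ι) K} (hA : A ∈ Matrix.symplecticGroup ι K) {x : K} (hx0 : x ≠ 0)
    (hx : A.charpoly.IsRoot x) : A.charpoly.IsRoot x⁻¹ := by
  rw [Polynomial.IsRoot, Matrix.eval_charpoly] at hx ⊢
  have h1 : (Matrix.scalar (ι ⊕ ι) x - A) * (Matrix.J ι K * A.transpose) =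
      Matrix.J ι K * (-x • (Matrix.scalar (ι ⊕ ι) x⁻¹ - A)).transpose := by
    rw [Matrix.sub_mul, ← Matrix.mul_assoc A, SymplecticGroup.mem_iff.1 hA]
    simp [← Matrix.smul_one_eq_diagonal, smul_sub, smul_smul, hx0]
    simp [Matrix.mul_add, sub_eq_neg_add]
  have h2 := congrArg Matrix.det h1
  rw [Matrix.det_mul, hx, zero_mul, Matrix.det_mul, Matrix.det_transpose, Matrix.det_smul] at h2
  have h3 := (Matrix.isUnit_det_J ι K).ne_zero
  simpa [h3, hx0] using h2.symm

open Polynomial in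
/-- The roots of a polynomial over a finite field are closed under the Frobenius map. -/
theorem FiniteField.isRoot_map_pow_card {F K : Type*} [Field F] [Fintype F] [Field K] [Algebra F K]
    {f : F[X]} {x : K} (hx : (f.map (algebraMap F K)).IsRoot x) :
    (f.map (algebraMap F K)).IsRoot (x ^ Fintype.card F) := by
  rw [IsRoot, eval_map_algebraMap] at hx ⊢
  rw [← expand_aeval, FiniteField.expand_card, map_pow, hx, zero_pow Fintype.card_ne_zero]

/-- Lifting the exponent: if `e` is the order of `q` modulo the odd prime `p` and `p ^ r` exactly
divides `q ^ e - 1`, then `p ^ (r + v)` divides `q ^ (e * m) - 1` if and only if `p ^ v ∣ m`. -/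
theorem Nat.pow_dvd_pow_orderOf_mul_sub_one_iff {p q e r v m : ℕ} (hp : p.Prime) (hodd : Odd p)
    (hpq : ¬ p ∣ q) (hpe : p ∣ q ^ e - 1) (hr : p ^ r ∣ q ^ e - 1 ∧ ¬ p ^ (r + 1) ∣ q ^ e - 1) :
    p ^ (r + v) ∣ q ^ (e * m) - 1 ↔ p ^ v ∣ m := by
  have h := Nat.emultiplicity_pow_sub_pow hp hodd (x := q ^ e) (y := 1) hpe
    (fun h => hpq (hp.dvd_of_dvd_pow h)) m
  rw [one_pow, ← pow_mul, emultiplicity_eq_coe.2 hr] at h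
  rw [pow_dvd_iff_le_emultiplicity, pow_dvd_iff_le_emultiplicity, h]
  push_cast
  exact (ENat.add_le_add_iff_left (ENat.natCast_ne_top r))

/-- The multiplicative order of `-q` modulo `p ^ k` is divisible by `2 * e * p ^ v`. -/
theorem Int.two_mul_orderOf_mul_pow_dvd_of_dvd_neg_pow_sub_one {p q e r v N : ℕ} (hp : p.Prime)
    (hodd : Odd p) (hpq : ¬ p ∣ q) (he : orderOf (q : ZMod p) = e) (heodd : Odd e)
    (hr : p ^ r ∣ q ^ e - 1 ∧ ¬ p ^ (r + 1) ∣ q ^ e - 1) (hr0 : r ≠ 0) (hpe : p ∣ q ^ e - 1)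
    (hN : (p : ℤ) ^ (r + v) ∣ (-(q : ℤ)) ^ N - 1) : 2 * e * p ^ v ∣ N := by
  have hq0 : 0 < q := Nat.pos_of_ne_zero fun h => hpq (h ▸ dvd_zero p)
  have : Fact p.Prime := ⟨hp⟩
  have hNp : (-(q : ZMod p)) ^ N = 1 := by
    have h1 : (p : ℤ) ∣ (-(q : ℤ)) ^ N - 1 := (dvd_pow_self _ (by omega)).trans hN
    have := (ZMod.intCast_zmod_eq_zero_iff_dvd _ p).2 h1
    push_cast at this
    exact sub_eq_zero.1 this
  have heN : e ∣ N := by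
    have h2 : e ∣ 2 * N := by
      rw [← he, orderOf_dvd_iff_pow_eq_one, pow_mul, ← even_two.neg_pow, ← pow_mul, mul_comm,
        pow_mul, hNp, one_pow]
    exact (Nat.coprime_two_right.2 heodd).dvd_of_dvd_mul_left h2
  have hqN : (q : ZMod p) ^ N = 1 := by rwa [← orderOf_dvd_iff_pow_eq_one, he]
  have hev : Even N := by
    by_contra h
    rw [Nat.not_even_iff_odd] at h
    rw [h.neg_pow, hqN] at hNp
    have : Fact (2 < p) := ⟨by have := hp.two_le; rcases hodd with ⟨a, ha⟩; omega⟩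
    exact ZMod.neg_one_ne_one hNp
  obtain ⟨M, rfl⟩ := heN
  rw [hev.neg_pow] at hN
  have h3 : p ^ (r + v) ∣ q ^ (e * M) - 1 := by
    zify [Nat.one_le_pow (e * M) q hq0]
    exact hN
  rw [Nat.pow_dvd_pow_orderOf_mul_sub_one_iff hp hodd hpq hpe hr] at h3
  have h2M : 2 ∣ M :=
    (Nat.coprime_two_left.2 heodd).dvd_of_dvd_mul_left (even_iff_two_dvd.1 hev)
  rw [mul_comm 2 e, mul_assoc]
  exact mul_dvd_mul_left e
    ((Nat.coprime_two_left.2 hodd.pow).mul_dvd_of_dvd_of_dvd h2M h3)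

/-- The embedding of `GL` into the symplectic group as a Levi subgroup. -/
def SymplecticGroup.ofGL (ι K : Type*) [Fintype ι] [DecidableEq ι] [CommRing K] :
    (Matrix ι ι K)ˣ →* Matrix.symplecticGroup ι K where
  toFun A := ⟨Matrix.fromBlocks A 0 0 (↑A⁻¹ : Matrix ι ι K).transpose, by
    rw [SymplecticGroup.fromBlocks_mem_iff]
    simp [← Matrix.transpose_mul]⟩
  map_one' := by ext : 1; simp
  map_mul' A B := by
    ext : 1
    simp [Matrix.fromBlocks_multiply, Matrix.transpose_mul]

theorem SymplecticGroup.ofGL_injective (ι K : Type*) [Fintype ι] [DecidableEq ι] [CommRing K] :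
    Function.Injective (SymplecticGroup.ofGL ι K) := fun _ _ h =>
  Units.ext (Matrix.fromBlocks_inj.1 (congrArg Subtype.val h)).1

/-- The units of the degree `d` extension of `F` embed into `GL_n(F)` for `d ≤ n`. -/
theorem FiniteField.card_pow_sub_one_dvd_exponent_GL {F : Type*} [Field F] [Fintype F] {d n : ℕ}
    (hd : d ≠ 0) (hdn : d ≤ n) :
    Fintype.card F ^ d - 1 ∣ Monoid.exponent (Matrix (Fin n) (Fin n) F)ˣ := by
  obtain ⟨p, hp⟩ := CharP.exists F
  have : Fact p.Prime := ⟨CharP.char_is_prime F p⟩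
  have : NeZero d := ⟨hd⟩
  let K := FiniteField.Extension F p d
  have hfr : Module.finrank F (K × (Fin (n - d) → F)) = n := by
    rw [Module.finrank_prod, FiniteField.finrank_extension]
    simp [hdn]
  let b := Module.finBasisOfFinrankEq F (K × (Fin (n - d) → F)) hfr
  let φ : K →* Matrix (Fin n) (Fin n) F :=
    { toFun := fun a => LinearMap.toMatrix b b ((LinearMap.mulLeft F a).prodMap LinearMap.id)
      map_one' := by
        rw [← LinearMap.toMatrix_one b]
        congr 1
        ext <;> simp
      map_mul' := fun x y => by
        rw [← LinearMap.toMatrix_mul]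
        congr 1
        ext <;> simp }
  have hφ : Function.Injective φ := by
    intro x y hxy
    have h := LinearMap.congr_fun ((LinearMap.toMatrix b b).injective hxy) (1, 0)
    simpa using congrArg Prod.fst h
  have h := Monoid.exponent_dvd_of_monoidHom (Units.map φ) (Units.map_injective hφ)
  rwa [IsCyclic.exponent_eq_card, Nat.card_units, FiniteField.natCard_extension,
    Nat.card_eq_fintype_card] at h


/-- Let `p` be an odd prime not dividing the prime power `q`, let `e` be the
multiplicative order of `q` mod `p` and suppose `e` is odd, let `p^r` exactly divide
`q^e - 1`, and let `2e·p^v ≤ 2n < 2e·p^(v+1)`. Then the `p`-part of the exponent of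
`Sp_{2n}(F_q)` is `p^(r+v)`. -/
theorem exponent_p_part_symplecticGroup_odd_order (p q : ℕ) (hp : p.Prime)
    (hodd : Odd p) (hq : IsPrimePow q) (hpq : ¬ p ∣ q)
    (F : Type) [Field F] [Fintype F] (hF : Fintype.card F = q)
    (e r v n : ℕ) (he : orderOf (q : ZMod p) = e) (heodd : Odd e)
    (hr : p ^ r ∣ q ^ e - 1 ∧ ¬ p ^ (r + 1) ∣ q ^ e - 1)
    (hn1 : 2 * e * p ^ v ≤ 2 * n) (hn2 : 2 * n < 2 * e * p ^ (v + 1)) :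
    p ^ (r + v) ∣ Monoid.exponent (Matrix.symplecticGroup (Fin n) F) ∧
      ¬ p ^ (r + v + 1) ∣ Monoid.exponent (Matrix.symplecticGroup (Fin n) F) := by
  have : Fact p.Prime := ⟨hp⟩
  have hq0 : 0 < q := hq.pos
  have hpe : p ∣ q ^ e - 1 := by
    rw [← ZMod.natCast_eq_zero_iff, Nat.cast_sub (Nat.one_le_pow e q hq0)]
    simp [← he, pow_orderOf_eq_one]
  have hr0 : r ≠ 0 := by
    rintro rfl
    exact hr.2 (by simpa using hpe)
  refine ⟨?_, fun hdvd => ?_⟩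
  · have hd : e * p ^ v ≠ 0 := mul_ne_zero heodd.pos.ne' (pow_pos hp.pos v).ne'
    have hdn : e * p ^ v ≤ n := by
      rw [mul_assoc] at hn1
      omega
    have h1 : p ^ (r + v) ∣ q ^ (e * p ^ v) - 1 :=
      (Nat.pow_dvd_pow_orderOf_mul_sub_one_iff hp hodd hpq hpe hr).2 dvd_rfl
    rw [← hF] at h1
    exact (h1.trans (FiniteField.card_pow_sub_one_dvd_exponent_GL hd hdn)).trans
      (Monoid.exponent_dvd_of_monoidHom _ (SymplecticGroup.ofGL_injective (Fin n) F))
  · obtain ⟨g, hg⟩ := hp.exists_orderOf_eq_pow_factorization_exponent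
      (Matrix.symplecticGroup (Fin n) F)
    have hfac := (hp.pow_dvd_iff_le_factorization Monoid.exponent_ne_zero_of_finite).1 hdvd
    obtain ⟨k, hk⟩ : ∃ k, (Monoid.exponent (Matrix.symplecticGroup (Fin n) F)).factorization p =
      k + 1 := ⟨_, (Nat.sub_add_cancel (by omega)).symm⟩
    rw [hk] at hg hfac
    let K := AlgebraicClosure F
    let A := g.1.map (algebraMap F K)
    have hA : A ∈ Matrix.symplecticGroup (Fin n) K := SymplecticGroup.map_mem g.2 _
    have hord : orderOf A = p ^ (k + 1) := by
      rw [← hg, ← orderOf_submonoid]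
      exact orderOf_injective ((algebraMap F K).mapMatrix (m := Fin n ⊕ Fin n)).toMonoidHom
        (Matrix.map_injective (algebraMap F K).injective) g.1
    have hpK : (p : K) ≠ 0 := by
      intro h
      have hpF : (p : F) = 0 := (algebraMap F K).injective (by simpa using h)
      have hqF : (q : F) = 0 := by rw [← hF, FiniteField.cast_card_eq_zero]
      obtain ⟨c, hc⟩ := CharP.exists F
      have hcp := (Nat.prime_dvd_prime_iff_eq (CharP.char_is_prime F c) hp).1
        ((CharP.cast_eq_zero_iff F c p).1 hpF)
      exact hpq (hcp ▸ (CharP.cast_eq_zero_iff F c q).1 hqF)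
    obtain ⟨ζ, hζ, hζord⟩ := Matrix.exists_isRoot_charpoly_orderOf_eq hp hpK hord
    have hζ0 : ζ ≠ 0 := by
      rintro rfl
      exact (pow_pos hp.pos (k + 1)).ne' (by rw [← hζord, orderOf_zero])
    have hroot : ∀ i : ℕ, A.charpoly.IsRoot (ζ ^ ((-(q : ℤ)) ^ i)) := by
      intro i
      induction i with
      | zero => simpa using hζ
      | succ i ih =>
        rw [pow_succ, zpow_mul, zpow_neg, zpow_natCast]
        refine SymplecticGroup.isRoot_charpoly_inv hA (pow_ne_zero _ (zpow_ne_zero _ hζ0)) ?_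
        have hmap : A.charpoly = g.1.charpoly.map (algebraMap F K) := Matrix.charpoly_map _ _
        rw [hmap] at ih ⊢
        have := FiniteField.isRoot_map_pow_card ih
        rwa [hF] at this
    have hinj : Set.InjOn (fun i : ℕ => ζ ^ ((-(q : ℤ)) ^ i))
        (Finset.range (2 * e * p ^ (v + 1))) := by
      have key : ∀ i j : ℕ, i < j → j < 2 * e * p ^ (v + 1) →
          ζ ^ ((-(q : ℤ)) ^ i) ≠ ζ ^ ((-(q : ℤ)) ^ j) := by
        intro i j hij hj heq
        have h1 : ζ ^ ((-(q : ℤ)) ^ j - (-(q : ℤ)) ^ i) = 1 := by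
          rw [zpow_sub₀ hζ0, heq, div_self (zpow_ne_zero _ hζ0)]
        have h2 : ((p : ℤ) ^ (k + 1)) ∣ (-(q : ℤ)) ^ j - (-(q : ℤ)) ^ i := by
          have h4 : orderOf (Units.mk0 ζ hζ0) = p ^ (k + 1) := by
            rw [← hζord, ← orderOf_units, Units.val_mk0]
          have h5 := (orderOf_dvd_iff_zpow_eq_one (x := Units.mk0 ζ hζ0)).2
            (Units.ext (by simpa using h1))
          rw [h4] at h5
          exact_mod_cast h5
        obtain ⟨N, rfl⟩ := Nat.exists_eq_add_of_lt hij
        have h3 : (-(q : ℤ)) ^ (i + N + 1) - (-(q : ℤ)) ^ i =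
            (-(q : ℤ)) ^ i * ((-(q : ℤ)) ^ (N + 1) - 1) := by ring
        have hcop : IsCoprime ((p : ℤ) ^ (k + 1)) ((-(q : ℤ)) ^ i) :=
          (IsCoprime.neg_right (Nat.isCoprime_iff_coprime.2
            ((Nat.Prime.coprime_iff_not_dvd hp).2 hpq))).pow
        rw [h3] at h2
        have h6 := Int.two_mul_orderOf_mul_pow_dvd_of_dvd_neg_pow_sub_one hp hodd hpq he heodd hr
          (v := v + 1) hr0 hpe ((pow_dvd_pow (p : ℤ) hfac).trans (hcop.dvd_of_dvd_mul_left h2))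
        have := Nat.le_of_dvd (Nat.succ_pos N) h6
        omega
      intro i hi j hj hij
      simp only [Finset.coe_range, Set.mem_Iio] at hi hj
      rcases lt_trichotomy i j with h | h | h
      · exact absurd hij (key i j h hj)
      · exact h
      · exact absurd hij.symm (key j i h hi)
    classical
    have hcard : 2 * e * p ^ (v + 1) ≤ A.charpoly.roots.toFinset.card := by
      rw [← Finset.card_range (2 * e * p ^ (v + 1)), ← Finset.card_image_of_injOn hinj]
      refine Finset.card_le_card fun x hx => ?_
      obtain ⟨i, -, rfl⟩ := Finset.mem_image.1 hx
      rw [Multiset.mem_toFinset, Polynomial.mem_roots A.charpoly_monic.ne_zero]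
      exact hroot i
    have hdeg := (Multiset.toFinset_card_le _).trans A.charpoly.card_roots'
    rw [Matrix.charpoly_natDegree_eq_dim, Fintype.card_sum, Fintype.card_fin] at hdeg
    omega
end

section
/- Let p be an odd prime and q a prime power with p not dividing q. Let e = ord_p(q) be the multiplicative order of q modulo p and suppose e is even. Let r be such that p^r exactly divides q^e − 1, and let v, n be natural numbers with e·p^v ≤ 2n < e·p^(v+1). Then exp_p(Sp_{2n}(F_q)) = p^(r+v). -/
open Polynomial Matrix

/-- If `p ^ r` exactly divides `q ^ e - 1`, where `e` is the order of `q` modulo `p`, then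
`p ^ (r + k)` divides `q ^ d - 1` if and only if `e * p ^ k` divides `d`. -/
theorem Nat.pow_dvd_pow_sub_one_iff_mul_pow_dvd {p q e r : ℕ} (hp : p.Prime) (hodd : Odd p)
    (hq : 0 < q) (hpq : ¬ p ∣ q) (he : orderOf (q : ZMod p) = e)
    (hr : p ^ r ∣ q ^ e - 1 ∧ ¬ p ^ (r + 1) ∣ q ^ e - 1) {d k : ℕ} (hrk : 0 < r + k) :
    p ^ (r + k) ∣ q ^ d - 1 ↔ e * p ^ k ∣ d := by
  have one_dvd_iff (d : ℕ) : p ∣ q ^ d - 1 ↔ e ∣ d := by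
    rw [← he, orderOf_dvd_iff_pow_eq_one, ← ZMod.natCast_eq_zero_iff,
      Nat.cast_sub (Nat.one_le_pow _ _ hq), sub_eq_zero]
    simp
  have lte (c : ℕ) : p ^ (r + k) ∣ q ^ (e * c) - 1 ↔ p ^ k ∣ c := by
    have h := Nat.emultiplicity_pow_sub_pow hp hodd (x := q ^ e) (y := 1)
      ((one_dvd_iff e).2 dvd_rfl) (fun h ↦ hpq (hp.dvd_of_dvd_pow h)) c
    rw [emultiplicity_eq_coe.2 hr, one_pow, ← pow_mul] at h
    rw [pow_dvd_iff_le_emultiplicity, pow_dvd_iff_le_emultiplicity, h, Nat.cast_add,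
      ENat.add_le_add_iff_left (ENat.natCast_ne_top r)]
  constructor
  · intro h
    obtain ⟨c, rfl⟩ := (one_dvd_iff d).1 ((dvd_pow_self p hrk.ne').trans h)
    exact mul_dvd_mul_left e ((lte c).1 h)
  · intro h
    obtain ⟨c, rfl⟩ := (dvd_mul_right e _).trans h
    by_cases he0 : e = 0
    · simp [he0]
    · exact (lte c).2 ((mul_dvd_mul_iff_left he0).1 h)

/-- A matrix `M` over a finite field with `M ^ a = 1`, where `a` is nonzero in the field, satisfies
`M ^ b = 1` as soon as `b` is a multiple of the order of every possible eigenvalue of `M`. -/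
theorem Matrix.pow_eq_one_of_forall_gcd_dvd {ι F : Type*} [Fintype ι] [DecidableEq ι]
    [Field F] [Fintype F] {M : Matrix ι ι F} {a b : ℕ} (ha : (a : F) ≠ 0) (hb : b ≠ 0)
    (hM : M ^ a = 1)
    (h : ∀ d, 0 < d → d ≤ Fintype.card ι → a.gcd (Fintype.card F ^ d - 1) ∣ b) :
    M ^ b = 1 := by
  classical
  have ha0 : 0 < a := Nat.pos_of_ne_zero (by rintro rfl; simp at ha)
  have hdvd : minpoly F M ∣ X ^ a - 1 := minpoly.dvd _ _ (by simp [hM])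
  have hsq : Squarefree (minpoly F M) := by
    refine Squarefree.squarefree_of_dvd hdvd (Separable.squarefree ?_)
    exact (X_pow_sub_one_separable_iff).2 ha
  have hne : minpoly F M ≠ 0 := minpoly.ne_zero M.isIntegral
  have hbne : (X ^ b - 1 : F[X]) ≠ 0 := X_pow_sub_C_ne_zero (Nat.pos_of_ne_zero hb) 1
  suffices minpoly F M ∣ X ^ b - 1 by
    have := (minpoly.dvd_iff).1 this
    simpa [sub_eq_zero] using this
  refine (UniqueFactorizationMonoid.radical_associated hsq.isRadical hne).symm.dvd.trans
    ((UniqueFactorizationMonoid.radical_dvd_iff_primeFactors_subset hbne).2 fun f hf ↦ ?_)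
  rw [UniqueFactorizationMonoid.mem_primeFactors,
    UniqueFactorizationMonoid.mem_normalizedFactors_iff' hne] at hf
  rw [UniqueFactorizationMonoid.mem_primeFactors,
    UniqueFactorizationMonoid.mem_normalizedFactors_iff' hbne]
  obtain ⟨hirr, hnorm, hfdvd⟩ := hf
  refine ⟨hirr, hnorm, ?_⟩
  have : Fact (Irreducible f) := ⟨hirr⟩
  have hfin : Module.Finite F (AdjoinRoot f) := (AdjoinRoot.powerBasis hirr.ne_zero).finite
  have : Finite (AdjoinRoot f) := Module.finite_of_finite F
  have : Fintype (AdjoinRoot f) := Fintype.ofFinite _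
  have hcard : Fintype.card (AdjoinRoot f) = Fintype.card F ^ f.natDegree := by
    rw [Module.card_eq_pow_finrank (K := F), (AdjoinRoot.powerBasis hirr.ne_zero).finrank,
      AdjoinRoot.powerBasis_dim]
  have root_pow (c : ℕ) : AdjoinRoot.root f ^ c = 1 ↔ f ∣ X ^ c - 1 := by
    rw [← AdjoinRoot.mk_eq_zero]
    simp [sub_eq_zero]
  have hra := (root_pow a).2 (hfdvd.trans hdvd)
  rw [← root_pow, ← orderOf_dvd_iff_pow_eq_one]
  have hr0 : AdjoinRoot.root f ≠ 0 := by
    intro h0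
    simp [h0, ha0.ne'] at hra
  refine (Nat.dvd_gcd (orderOf_dvd_of_pow_eq_one hra) (orderOf_dvd_of_pow_eq_one ?_)).trans
    (h f.natDegree hirr.natDegree_pos ?_)
  · rw [← hcard]
    exact FiniteField.pow_card_sub_one_eq_one _ hr0
  · rw [← M.charpoly_natDegree_eq_dim]
    exact natDegree_le_of_dvd (hfdvd.trans M.minpoly_dvd_charpoly) M.charpoly_monic.ne_zero

/-- Multiplication by an element is self-adjoint for the trace form. -/
theorem Algebra.traceMatrix_mul_leftMulMatrix {F L ι : Type*} [Field F] [Field L] [Algebra F L]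
    [Fintype ι] [DecidableEq ι] (b : Module.Basis ι F L) (s : L) :
    Algebra.traceMatrix F b * Algebra.leftMulMatrix b s =
      (Algebra.leftMulMatrix b s)ᵀ * Algebra.traceMatrix F b := by
  have h : (Algebra.traceForm F L).compRight (LinearMap.mulLeft F s) =
      (Algebra.traceForm F L).compLeft (LinearMap.mulLeft F s) := by
    ext x y
    simp [Algebra.traceForm_apply, mul_left_comm, mul_assoc]
  rw [Algebra.traceMatrix_of_basis, ← Algebra.toMatrix_lmul_eq,
    ← LinearMap.BilinForm.toMatrix_compRight, ← LinearMap.BilinForm.toMatrix_compLeft, h]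

/-- The image of a basis under an embedding is an eigenvector of the transposed multiplication
matrix. -/
theorem Algebra.transpose_leftMulMatrix_mulVec {F L K ι : Type*} [Field F] [Field L] [Algebra F L]
    [Field K] [Algebra F K] (f : L →ₐ[F] K)
    [Fintype ι] [DecidableEq ι] (b : Module.Basis ι F L) (s : L) :
    ((Algebra.leftMulMatrix b s).map (algebraMap F K))ᵀ *ᵥ (fun i ↦ f (b i)) =
      f s • fun i ↦ f (b i) := by
  ext j
  have h := congrArg f (b.sum_repr (s * b j))
  simp_rw [map_sum, map_smul, Algebra.smul_def, map_mul] at h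
  simpa [mulVec, dotProduct, Algebra.leftMulMatrix_eq_repr_mul] using h

/-- If `t` is separable of degree at most `n` over `F`, then `t` is an eigenvalue of (the transpose
of) an `n × n` matrix over `F` that is self-adjoint for a nondegenerate symmetric form. -/
theorem Matrix.exists_isSymm_mul_eq_transpose_mul_of_natDegree_minpoly_le {F K : Type*}
    [Field F] [Field K] [Algebra F K] {t : K} (ht : IsSeparable F t) {n : ℕ}
    (hn : (minpoly F t).natDegree ≤ n) :
    ∃ (T G : Matrix (Fin n) (Fin n) F) (u : Fin n → K),
      G.IsSymm ∧ IsUnit G.det ∧ G * T = Tᵀ * G ∧ u ≠ 0 ∧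
        (T.map (algebraMap F K))ᵀ *ᵥ u = t • u := by
  have hint : IsIntegral F t := IsSeparable.isIntegral ht
  have : Algebra.IsSeparable F (IntermediateField.adjoin F {t}) :=
    (IntermediateField.isSeparable_adjoin_simple_iff_isSeparable F K).2 ht
  let pb := IntermediateField.adjoin.powerBasis hint
  have hdim : pb.dim + (n - pb.dim) = n := Nat.add_sub_cancel' hn
  let e : Fin n ≃ Fin pb.dim ⊕ Fin (n - pb.dim) := (finCongr hdim.symm).trans finSumFinEquiv.symm
  let s := IntermediateField.AdjoinSimple.gen F t
  let T := fromBlocks (Algebra.leftMulMatrix pb.basis s) 0 0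
    (0 : Matrix (Fin (n - pb.dim)) (Fin (n - pb.dim)) F)
  let G := fromBlocks (Algebra.traceMatrix F pb.basis) 0 0
    (1 : Matrix (Fin (n - pb.dim)) (Fin (n - pb.dim)) F)
  let f := (IntermediateField.adjoin F {t}).val
  let u : Fin pb.dim ⊕ Fin (n - pb.dim) → K := Sum.elim (fun i ↦ f (pb.basis i)) 0
  have hG : G.IsSymm := by
    refine (isSymm_fromBlocks_iff).2 ⟨?_, by simp, by simp, by simp⟩
    ext i j
    simp only [Matrix.transpose_apply, Algebra.traceMatrix_apply, Algebra.traceForm_apply, mul_comm]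
  have hdet : IsUnit G.det := by
    simpa [G] using (det_traceMatrix_ne_zero' pb)
  have hGT : G * T = Tᵀ * G := by
    simp [G, T, fromBlocks_transpose, fromBlocks_multiply,
      Algebra.traceMatrix_mul_leftMulMatrix pb.basis s, -PowerBasis.coe_basis]
  have hu : u ≠ 0 := by
    intro h
    have := congrFun h (Sum.inl ⟨0, pb.dim_pos⟩)
    simp [u, f] at this
  have hTu : (T.map (algebraMap F K))ᵀ *ᵥ u = t • u := by
    have := Algebra.transpose_leftMulMatrix_mulVec f pb.basis s
    have hfs : f s = t := rfl
    rw [hfs] at this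
    ext (i | i)
    · simpa [T, u, fromBlocks_map, fromBlocks_transpose, fromBlocks_mulVec] using congrFun this i
    · simp [T, u, fromBlocks_map, fromBlocks_transpose, fromBlocks_mulVec]
  refine ⟨T.submatrix e e, G.submatrix e e, u ∘ e, hG.submatrix e, ?_, ?_, ?_, ?_⟩
  · rwa [det_submatrix_equiv_self]
  · rw [submatrix_mul_equiv, hGT, transpose_submatrix, submatrix_mul_equiv]
  · intro h
    exact hu (e.surjective.injective_comp_right (by simpa using h))
  · rw [← submatrix_map, transpose_submatrix, submatrix_mulVec_equiv]
    ext i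
    simp [hTu, Function.comp_assoc]

/-- If `ζ + ζ⁻¹` is an eigenvalue of a matrix that is self-adjoint for a nondegenerate symmetric
form, then `ζ` is an eigenvalue of a symplectic matrix. -/
theorem SymplecticGroup.exists_mem_map_mulVec_eq_smul {n F K : Type*} [Fintype n] [DecidableEq n]
    [Field F] [Field K] [Algebra F K] {ζ t : K} (hζ : ζ ≠ 0) (ht : t = ζ + ζ⁻¹)
    {T G : Matrix n n F} {u : n → K} (hG : G.IsSymm) (hdet : IsUnit G.det)
    (hGT : G * T = Tᵀ * G) (hu : u ≠ 0) (hTu : (T.map (algebraMap F K))ᵀ *ᵥ u = t • u) :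
    ∃ A ∈ symplecticGroup n F, ∃ w : n ⊕ n → K, w ≠ 0 ∧
      A.map (algebraMap F K) *ᵥ w = ζ • w := by
  have h1 : G * G⁻¹ = 1 := mul_nonsing_inv _ hdet
  have h2 : G⁻¹ * G = 1 := nonsing_inv_mul _ hdet
  have hGi : G⁻¹ᵀ = G⁻¹ := by rw [transpose_nonsing_inv, hG.eq]
  have hTi : T * G⁻¹ = G⁻¹ * Tᵀ := by
    calc T * G⁻¹ = G⁻¹ * (G * T) * G⁻¹ := by rw [← mul_assoc, h2, one_mul]
      _ = _ := by rw [hGT, mul_assoc, mul_assoc, h1, mul_one]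
  refine ⟨fromBlocks 0 (-G) G⁻¹ T, ?_,
    Sum.elim u (-(ζ • (G⁻¹.map (algebraMap F K) *ᵥ u))), ?_, ?_⟩
  · rw [SymplecticGroup.fromBlocks_mem_iff]
    refine ⟨by simp, ?_, ?_⟩
    · simp [hG.eq, hGT]
    · simp [hGi, h2]
  · intro h
    exact hu (funext fun i ↦ congrFun h (Sum.inl i))
  · have e1 : G.map (algebraMap F K) * G⁻¹.map (algebraMap F K) = 1 := by
      rw [← Matrix.map_mul, h1]; simp
    have e2 : T.map (algebraMap F K) * G⁻¹.map (algebraMap F K) =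
        G⁻¹.map (algebraMap F K) * (T.map (algebraMap F K))ᵀ := by
      rw [← Matrix.map_mul, hTi, Matrix.map_mul, transpose_map]
    rw [fromBlocks_map, fromBlocks_mulVec]
    ext (i | i)
    · simp [Matrix.map_neg, mulVec_neg, neg_mulVec, mulVec_smul, mulVec_mulVec, e1]
    · have : ζ * t = ζ ^ 2 + 1 := by rw [ht]; field_simp
      simp [mulVec_neg, mulVec_smul, mulVec_mulVec, e2]
      simp [← mulVec_mulVec, hTu, mulVec_smul]
      linear_combination (- (G⁻¹.map (algebraMap F K) *ᵥ u) i) * this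

/-- The order of every eigenvalue of a symplectic matrix divides the exponent of the symplectic
group. -/
theorem SymplecticGroup.orderOf_dvd_exponent_of_map_mulVec_eq_smul {l F K : Type*} [Fintype l]
    [DecidableEq l] [Field F] [Field K] [Algebra F K] {A : Matrix (l ⊕ l) (l ⊕ l) F}
    (hA : A ∈ symplecticGroup l F) {ζ : K}
    {w : l ⊕ l → K} (hw : w ≠ 0) (hAw : A.map (algebraMap F K) *ᵥ w = ζ • w) :
    orderOf ζ ∣ Monoid.exponent (symplecticGroup l F) := by
  have hpow (k : ℕ) : (A ^ k).map (algebraMap F K) *ᵥ w = ζ ^ k • w := by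
    induction k with
    | zero => simp
    | succ k ih =>
      rw [pow_succ, Matrix.map_mul, ← mulVec_mulVec, hAw, mulVec_smul, ih, smul_smul, pow_succ']
  have h1 := Monoid.pow_exponent_eq_one (⟨A, hA⟩ : symplecticGroup l F)
  have h2 : A ^ Monoid.exponent (symplecticGroup l F) = 1 := congrArg Subtype.val h1
  have h3 := hpow (Monoid.exponent (symplecticGroup l F))
  rw [h2, Matrix.map_one _ (map_zero _) (map_one _), one_mulVec] at h3
  obtain ⟨i, hi⟩ := Function.ne_iff.1 hw
  exact orderOf_dvd_of_pow_eq_one (mul_right_cancel₀ hi (by simpa using (congrFun h3 i).symm))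

/-- Every divisor of `|F| ^ m + 1`, where `0 < m ≤ n`, divides the exponent of `Sp_{2n}(F)`. -/
theorem SymplecticGroup.dvd_exponent_of_dvd_card_pow_add_one {F : Type*} [Field F] [Fintype F]
    {a m n : ℕ} (hm : 0 < m) (hmn : m ≤ n)
    (ha : a ∣ Fintype.card F ^ m + 1) :
    a ∣ Monoid.exponent (symplecticGroup (Fin n) F) := by
  let K := AlgebraicClosure F
  have haF : (a : F) ≠ 0 := by
    intro h
    obtain ⟨c, hc⟩ := ha
    have := congrArg (Nat.cast : ℕ → F) hc
    simp [h, hm.ne'] at this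
  have : NeZero (a : F) := ⟨haF⟩
  obtain ⟨ζ, hζ⟩ := HasEnoughRootsOfUnity.exists_primitiveRoot K a
  have ha0 : a ≠ 0 := by rintro rfl; simp at haF
  have hζ0 : ζ ≠ 0 := hζ.ne_zero ha0
  have hζm : ζ ^ Fintype.card F ^ m = ζ⁻¹ := by
    refine eq_inv_of_mul_eq_one_left ?_
    rwa [← pow_succ, hζ.pow_eq_one_iff_dvd]
  have hfrob (x : K) : ((FiniteField.frobeniusAlgHom F K) ^ m) x = x ^ Fintype.card F ^ m := by
    rw [AlgHom.coe_pow, FiniteField.coe_frobeniusAlgHom, pow_iterate]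
  have htm : (ζ + ζ⁻¹) ^ Fintype.card F ^ m = ζ + ζ⁻¹ := by
    rw [← hfrob, map_add, hfrob, hfrob, inv_pow, hζm, inv_inv, add_comm]
  have hint : IsIntegral F (ζ + ζ⁻¹) := Algebra.IsIntegral.isIntegral _
  have hdeg : (minpoly F (ζ + ζ⁻¹)).natDegree ∣ m := by
    refine (minpoly.irreducible hint).natDegree_dvd_of_dvd_X_pow_card_pow_sub_X (minpoly.dvd _ _ ?_)
    simp [Nat.card_eq_fintype_card, htm]
  obtain ⟨T, G, u, hG, hdet, hGT, hu, hTu⟩ :=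
    Matrix.exists_isSymm_mul_eq_transpose_mul_of_natDegree_minpoly_le
      (PerfectField.separable_of_irreducible (minpoly.irreducible hint))
      ((Nat.le_of_dvd hm hdeg).trans hmn)
  obtain ⟨A, hA, w, hw, hAw⟩ :=
    SymplecticGroup.exists_mem_map_mulVec_eq_smul hζ0 rfl hG hdet hGT hu hTu
  rw [hζ.eq_orderOf]
  exact SymplecticGroup.orderOf_dvd_exponent_of_map_mulVec_eq_smul hA hw hAw

/-- Let `p` be an odd prime not dividing the prime power `q`, let `e` be the
multiplicative order of `q` mod `p` and suppose `e` is even, let `p^r` exactly divide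
`q^e - 1`, and let `e·p^v ≤ 2n < e·p^(v+1)`. Then the `p`-part of the exponent of
`Sp_{2n}(F_q)` is `p^(r+v)`. -/
theorem exponent_p_part_symplecticGroup_even_order (p q : ℕ) (hp : p.Prime)
    (hodd : Odd p) (hq : IsPrimePow q) (hpq : ¬ p ∣ q)
    (F : Type) [Field F] [Fintype F] (hF : Fintype.card F = q)
    (e r v n : ℕ) (he : orderOf (q : ZMod p) = e) (heeven : Even e)
    (hr : p ^ r ∣ q ^ e - 1 ∧ ¬ p ^ (r + 1) ∣ q ^ e - 1)
    (hn1 : e * p ^ v ≤ 2 * n) (hn2 : 2 * n < e * p ^ (v + 1)) :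
    p ^ (r + v) ∣ Monoid.exponent (Matrix.symplecticGroup (Fin n) F) ∧
      ¬ p ^ (r + v + 1) ∣ Monoid.exponent (Matrix.symplecticGroup (Fin n) F) := by
  have hq0 : 0 < q := hq.pos
  have he0 : 0 < e := Nat.pos_of_ne_zero (by rintro rfl; simp at hn2)
  have hr0 : 0 < r := by
    refine Nat.pos_of_ne_zero fun h ↦ hr.2 ?_
    rw [h, zero_add, pow_one, ← ZMod.natCast_eq_zero_iff, Nat.cast_sub (Nat.one_le_pow _ _ hq0),
      Nat.cast_pow, ← he, pow_orderOf_eq_one, Nat.cast_one, sub_self]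
  have key {d k : ℕ} := Nat.pow_dvd_pow_sub_one_iff_mul_pow_dvd hp hodd hq0 hpq he hr (d := d)
    (k := k) (by omega)
  constructor
  · obtain ⟨h, rfl⟩ := heeven.two_dvd
    have hm : 0 < h * p ^ v := Nat.mul_pos (by omega) (pow_pos hp.pos v)
    refine SymplecticGroup.dvd_exponent_of_dvd_card_pow_add_one hm (m := h * p ^ v) (by linarith) ?_
    have hdvd := key.2 (dvd_refl (2 * h * p ^ v))
    have hfac : q ^ (2 * h * p ^ v) - 1 = (q ^ (h * p ^ v) + 1) * (q ^ (h * p ^ v) - 1) := by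
      rw [mul_assoc, mul_comm 2, pow_mul, ← Nat.sq_sub_sq, one_pow]
    rw [hfac] at hdvd
    rw [hF]
    refine Nat.Coprime.dvd_of_dvd_mul_right (Nat.Coprime.pow_left _ ?_) hdvd
    rw [hp.coprime_iff_not_dvd]
    intro h1
    have h2 : 2 * h ∣ h * p ^ v := by
      rw [← he, orderOf_dvd_iff_pow_eq_one]
      rw [← ZMod.natCast_eq_zero_iff, Nat.cast_sub (Nat.one_le_pow _ _ hq0), sub_eq_zero] at h1
      simpa using h1
    rw [mul_comm 2, mul_dvd_mul_iff_left (by omega)] at h2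
    exact (Nat.not_even_iff_odd.2 (hodd.pow (n := v))) (even_iff_two_dvd.2 h2)
  · intro hdvd
    have hpF : (p : F) ≠ 0 := by
      intro h
      have hco := (Nat.isCoprime_iff_coprime.2 ((Nat.Prime.coprime_iff_not_dvd hp).2 hpq)).map
        (Int.castRingHom F)
      have hqF : (q : F) = 0 := hF ▸ Nat.cast_card_eq_zero F
      simp [h, hqF] at hco
    obtain ⟨g, hg⟩ := hp.exists_orderOf_eq_pow_factorization_exponent (symplecticGroup (Fin n) F)
    rw [hp.pow_dvd_iff_le_factorization Monoid.exponent_ne_zero_of_finite] at hdvd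
    set N := (Monoid.exponent (symplecticGroup (Fin n) F)).factorization p
    have hgN : g.1 ^ p ^ N = 1 := congrArg Subtype.val (hg ▸ pow_orderOf_eq_one g)
    have hgv : g.1 ^ p ^ (r + v) = 1 := by
      refine Matrix.pow_eq_one_of_forall_gcd_dvd (a := p ^ N) (by simp [hpF])
        (pow_ne_zero _ hp.ne_zero) hgN fun d hd0 hd ↦ ?_
      obtain ⟨j, -, hj⟩ := (Nat.dvd_prime_pow hp).1 (Nat.gcd_dvd_left (p ^ N) (q ^ d - 1))
      rw [hF, hj]
      refine pow_dvd_pow p (Nat.le_of_lt_succ (not_le.1 fun hlt ↦ ?_))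
      have h1 : p ^ (r + (v + 1)) ∣ q ^ d - 1 :=
        (pow_dvd_pow p hlt).trans (hj ▸ Nat.gcd_dvd_right _ _)
      have h2 := Nat.le_of_dvd hd0 (key.1 h1)
      simp only [Fintype.card_sum, Fintype.card_fin] at hd
      omega
    have h3 : orderOf g ∣ p ^ (r + v) := orderOf_dvd_of_pow_eq_one (Subtype.ext hgv)
    rw [hg] at h3
    have := (Nat.pow_dvd_pow_iff_le_right hp.one_lt).1 h3
    omega
end

section
/- Let p be an odd prime and q a prime power with p not dividing q. Let e = ord_p(q) be the multiplicative order of q modulo p, suppose e is odd, and let r be such that p^r exactly divides q^e − 1. Then every Sylow p-subgroup of the symplectic group Sp_{2e}(F_q) is cyclic of order p^r. -/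
open Module in
/-- A finite-dimensional space carrying a nondegenerate alternating form has even dimension. -/
theorem LinearMap.BilinForm.even_finrank_of_isAlt {K V : Type*} [Field K] [AddCommGroup V]
    [Module K V] [FiniteDimensional K V] {B : LinearMap.BilinForm K V} (hB : B.Nondegenerate)
    (hA : B.IsAlt) : Even (finrank K V) := by
  obtain ⟨L, hL, hmax⟩ := WellFounded.has_min
    (r := ((· > ·) : Submodule K V → Submodule K V → Prop)) IsWellFounded.wf
    {L : Submodule K V | L ≤ B.orthogonal L}
    ⟨⊥, show ⊥ ≤ B.orthogonal ⊥ from bot_le⟩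
  have hLag : B.orthogonal L = L := by
    refine le_antisymm (fun x hx ↦ ?_) hL
    by_contra hxL
    refine hmax (L ⊔ Submodule.span K {x}) ?_ ?_
    · intro y hy z hz
      obtain ⟨a, ha, b, hb, rfl⟩ := Submodule.mem_sup.1 hy
      obtain ⟨c, hc, d, hd, rfl⟩ := Submodule.mem_sup.1 hz
      obtain ⟨s, rfl⟩ := Submodule.mem_span_singleton.1 hb
      obtain ⟨t, rfl⟩ := Submodule.mem_span_singleton.1 hd
      have hca : B c a = 0 := hL ha c hc
      have hcx : B c x = 0 := hx c hc
      have hxa : B x a = 0 := hA.eq_iff.1 (hx a ha)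
      simp [hca, hcx, hxa, hA.self_eq_zero]
    · refine lt_of_le_of_ne le_sup_left fun h ↦ hxL ?_
      rw [h]
      exact Submodule.mem_sup_right (Submodule.mem_span_singleton_self x)
  have h := LinearMap.BilinForm.finrank_orthogonal hB L
  have hle := L.finrank_le
  rw [hLag] at h
  exact ⟨finrank K L, by omega⟩

open Module in
/-- The fixed space of an isometry of a symplectic space whose order is invertible in the base
field has even dimension. -/
theorem LinearMap.BilinForm.even_finrank_eqLocus_of_pow_eq_one {K V : Type*} [Field K]
    [AddCommGroup V] [Module K V] [FiniteDimensional K V] {B : LinearMap.BilinForm K V}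
    (hB : B.Nondegenerate) (hA : B.IsAlt) {T : End K V} (hT : ∀ x y, B (T x) (T y) = B x y)
    {N : ℕ} (hN : (N : K) ≠ 0) (hTN : T ^ N = 1) :
    Even (finrank K (LinearMap.eqLocus T 1)) := by
  refine LinearMap.BilinForm.even_finrank_of_isAlt (B := B.restrict (LinearMap.eqLocus T 1))
    (B.nondegenerate_restrict_of_disjoint_orthogonal hA.isRefl ?_) fun x ↦ hA x
  refine Submodule.disjoint_def.2 fun x hx hx' ↦ hB.1 x fun y ↦ ?_
  have hTx : T x = x := hx
  have hxi (i : ℕ) : B x ((T ^ i) y) = B x y := by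
    induction i with
    | zero => simp
    | succ i ih => rw [pow_succ', Module.End.mul_apply, ← ih, ← hT x ((T ^ i) y), hTx]
  have hsum : (∑ i ∈ Finset.range N, (T ^ i) y) ∈ LinearMap.eqLocus T 1 := by
    have h := LinearMap.congr_fun (mul_geom_sum T N) y
    rw [hTN] at h
    simpa [LinearMap.mem_eqLocus, sub_eq_zero, LinearMap.sum_apply] using h
  have h0 : B x (∑ i ∈ Finset.range N, (T ^ i) y) = 0 := hA.eq_iff.1 (hx' _ hsum)
  rw [map_sum, Finset.sum_congr rfl fun i _ ↦ hxi i] at h0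
  simpa [hN] using h0

/-- A finite group acting on a finite type with a global fixed point, and freely elsewhere, has
order dividing the number of remaining points. -/
theorem MulAction.card_dvd_card_sub_one {G X : Type*} [Group G] [Finite G] [Finite X]
    [MulAction G X] (x₀ : X) (h₀ : ∀ g : G, g • x₀ = x₀)
    (hfree : ∀ (g : G) (x : X), x ≠ x₀ → g • x = x → g = 1) :
    Nat.card G ∣ Nat.card X - 1 := by
  classical
  have := Fintype.ofFinite G
  have := Fintype.ofFinite X
  have := Fintype.ofFinite (Quotient (MulAction.orbitRel G X))
  have h := MulAction.sum_card_fixedBy_eq_card_orbits_mul_card_group G X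
  have hfix (g : G) (hg : g ≠ 1) : Fintype.card (MulAction.fixedBy X g) = 1 := by
    refine Fintype.card_eq_one_iff.2 ⟨⟨x₀, h₀ g⟩, fun y ↦ Subtype.ext ?_⟩
    by_contra hy
    exact hg (hfree g y hy y.2)
  have hone : Fintype.card (MulAction.fixedBy X (1 : G)) = Fintype.card X :=
    Fintype.card_congr ((Equiv.setCongr (by ext; simp)).trans (Equiv.Set.univ X))
  rw [← Finset.add_sum_erase _ _ (Finset.mem_univ (1 : G)), hone,
    Finset.sum_congr rfl fun g hg ↦ hfix g (Finset.ne_of_mem_erase hg)] at h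
  simp only [Finset.sum_const, Finset.card_erase_of_mem (Finset.mem_univ _), Finset.card_univ,
    smul_eq_mul, mul_one] at h
  have hX : 0 < Fintype.card X := Fintype.card_pos_iff.2 ⟨x₀⟩
  have hG : 0 < Fintype.card G := Fintype.card_pos
  rw [Nat.card_eq_fintype_card, Nat.card_eq_fintype_card]
  refine (Nat.dvd_add_left (dvd_refl (Fintype.card G))).1 ?_
  rw [show Fintype.card X - 1 + Fintype.card G = Fintype.card X + (Fintype.card G - 1) by omega, h]
  exact dvd_mul_left _ _

open Module in
/-- If `T` has `p`-power order, then the cardinalities of the space and of the fixed space of `T`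
agree modulo `p`. -/
theorem Module.End.pow_finrank_eqLocus_modEq {K V : Type*} [Field K] [Finite K] [AddCommGroup V]
    [Module K V] [FiniteDimensional K V] {p k : ℕ} [Fact p.Prime] {T : End K V}
    (hT : T ^ p ^ k = 1) :
    Nat.card K ^ finrank K V ≡ Nat.card K ^ finrank K (LinearMap.eqLocus T 1) [MOD p] := by
  classical
  have : Finite V := Module.finite_of_finite K
  have := Fintype.ofFinite V
  let f : Function.End V := ⇑T
  have hf (n : ℕ) : f ^ n = ⇑(T ^ n) := by
    induction n with
    | zero => rfl
    | succ n ih => rw [pow_succ, pow_succ, ih]; rfl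
  have hpow : f ^ p ^ k = 1 := by
    rw [hf, hT]
    rfl
  have h := Equiv.Perm.card_fixedPoints_modEq hpow
  rw [← Module.natCard_eq_pow_finrank, ← Module.natCard_eq_pow_finrank, Nat.card_eq_fintype_card]
  convert h
  rw [← Nat.card_eq_fintype_card]
  rfl

open Module in
/-- If the order `e` of `#K` modulo `p` is odd, then an isometry of `p`-power order of a
symplectic space of dimension `2 * e` over `K` fixing a nonzero vector is trivial. -/
theorem LinearMap.BilinForm.eq_one_of_apply_eq_self {K V : Type*} [Field K] [Finite K]
    [AddCommGroup V] [Module K V] [FiniteDimensional K V] {B : LinearMap.BilinForm K V}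
    (hB : B.Nondegenerate) (hA : B.IsAlt) {p k : ℕ} [Fact p.Prime] (hpK : (p : K) ≠ 0)
    (hodd : Odd (orderOf (Nat.card K : ZMod p)))
    (hV : finrank K V = 2 * orderOf (Nat.card K : ZMod p))
    {T : End K V} (hT : ∀ x y, B (T x) (T y) = B x y) (hTp : T ^ p ^ k = 1)
    {x : V} (hx : x ≠ 0) (hTx : T x = x) : T = 1 := by
  have heven := LinearMap.BilinForm.even_finrank_eqLocus_of_pow_eq_one hB hA hT
    (N := p ^ k) (by simpa using pow_ne_zero k hpK) hTp
  have hmod := (ZMod.natCast_eq_natCast_iff _ _ _).2 (Module.End.pow_finrank_eqLocus_modEq hTp)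
  rw [hV, Nat.cast_pow, Nat.cast_pow, mul_comm, pow_mul, pow_orderOf_eq_one, one_pow] at hmod
  obtain ⟨c, hc⟩ := orderOf_dvd_of_pow_eq_one hmod.symm
  have hle := (LinearMap.eqLocus T 1).finrank_le
  have hpos : 0 < finrank K (LinearMap.eqLocus T 1) :=
    Module.finrank_pos_iff_exists_ne_zero.2
      ⟨⟨x, hTx⟩, fun h ↦ hx (congrArg Subtype.val h)⟩
  have hc2 : c = 2 := by
    have : c ≤ 2 := by
      rw [hV, hc, mul_comm] at hle
      exact Nat.le_of_mul_le_mul_right hle hodd.pos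
    interval_cases c
    · omega
    · rw [hc, mul_one] at heven
      exact absurd heven (Nat.not_even_iff_odd.2 hodd)
    · rfl
  have htop : LinearMap.eqLocus T 1 = ⊤ :=
    Submodule.eq_top_of_finrank_eq (by rw [hc, hc2, hV, mul_comm])
  exact LinearMap.eqLocus_eq_top.1 htop

open Matrix in
/-- The bilinear form of the matrix `J` is nondegenerate. -/
theorem Matrix.nondegenerate_toBilin'_J (l K : Type*) [Fintype l] [DecidableEq l] [Field K] :
    (Matrix.toBilin' (Matrix.J l K)).Nondegenerate :=
  Matrix.nondegenerate_toBilin'_iff.2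
    (Matrix.nondegenerate_of_det_ne_zero (Matrix.isUnit_det_J l K).ne_zero)

open Matrix in
/-- The bilinear form of the matrix `J` is alternating. -/
theorem Matrix.isAlt_toBilin'_J (l K : Type*) [Fintype l] [DecidableEq l] [Field K] :
    (Matrix.toBilin' (Matrix.J l K)).IsAlt := by
  intro x
  rw [Matrix.toBilin'_apply', Matrix.J, Matrix.fromBlocks_mulVec]
  simp [dotProduct, Fintype.sum_sum_type, Matrix.neg_mulVec, mul_comm]

open Matrix in
theorem SymplecticGroup.toBilin'_J_mulVec {l K : Type*} [Fintype l] [DecidableEq l] [Field K]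
    {A : Matrix (l ⊕ l) (l ⊕ l) K} (hA : A ∈ symplecticGroup l K) (x y : l ⊕ l → K) :
    Matrix.toBilin' (Matrix.J l K) (A *ᵥ x) (A *ᵥ y) = Matrix.toBilin' (Matrix.J l K) x y := by
  rw [Matrix.toBilin'_apply', Matrix.toBilin'_apply', Matrix.mulVec_mulVec,
    ← Matrix.vecMul_transpose, ← Matrix.dotProduct_mulVec, Matrix.mulVec_mulVec,
    ← Matrix.mul_assoc, SymplecticGroup.mem_iff'.1 hA]

open Matrix in
/-- If the order `e` of `#K` modulo `p` is odd, then the order of a `p`-subgroup of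
`Sp (2 * e, K)` divides `#K ^ (2 * e) - 1`. -/
theorem IsPGroup.card_symplecticGroup_dvd {K : Type*} [Field K] [Finite K] {p e : ℕ}
    [Fact p.Prime] (hpK : (p : K) ≠ 0) (he : orderOf (Nat.card K : ZMod p) = e) (hodd : Odd e)
    {P : Subgroup (symplecticGroup (Fin e) K)} (hP : IsPGroup p P) :
    Nat.card P ∣ Nat.card K ^ (2 * e) - 1 := by
  let ρ : symplecticGroup (Fin e) K →* Module.End K (Fin e ⊕ Fin e → K) :=
    (Matrix.toLinAlgEquiv' (R := K) (n := Fin e ⊕ Fin e)).toAlgHom.toMonoidHom.comp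
      (symplecticGroup (Fin e) K).subtype
  have hinj : Function.Injective ρ :=
    Matrix.toLinAlgEquiv'.injective.comp Subtype.val_injective
  have hsmul (g : P) (x : Fin e ⊕ Fin e → K) : g • x = ρ g x := rfl
  have hcard : Nat.card (Fin e ⊕ Fin e → K) = Nat.card K ^ (2 * e) := by
    rw [Nat.card_fun]
    simp [two_mul]
  rw [← hcard]
  refine MulAction.card_dvd_card_sub_one 0 (fun g ↦ by rw [hsmul, map_zero]) fun g x hx hgx ↦ ?_
  obtain ⟨k, hk⟩ := hP g
  have hk' : ρ g ^ p ^ k = 1 := by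
    rw [← map_pow, ← Subgroup.coe_pow, hk, Subgroup.coe_one, map_one]
  have h1 : ρ g = 1 := LinearMap.BilinForm.eq_one_of_apply_eq_self
    (Matrix.nondegenerate_toBilin'_J (Fin e) K) (Matrix.isAlt_toBilin'_J _ _) hpK (he ▸ hodd)
    (by simp [he, two_mul])
    (SymplecticGroup.toBilin'_J_mulVec g.1.2) hk' hx hgx
  exact Subtype.ext (hinj (h1.trans (map_one ρ).symm))

open Matrix in
/-- The embedding of the units of an algebra with a basis indexed by `l` in the symplectic group,
through the Levi subgroup of block diagonal matrices. -/
noncomputable def SymplecticGroup.ofUnits {l K L : Type*} [Fintype l] [DecidableEq l] [Field K]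
    [CommRing L] [Algebra K L] (b : Module.Basis l K L) : Lˣ →* symplecticGroup l K where
  toFun u := ⟨fromBlocks (Algebra.leftMulMatrix b u) 0 0
    (Algebra.leftMulMatrix b (u⁻¹ : Lˣ))ᵀ, by
      rw [SymplecticGroup.fromBlocks_mem_iff]
      simp [← Matrix.transpose_mul, ← map_mul]⟩
  map_one' := by
    apply Subtype.ext
    simp
  map_mul' u v := by
    apply Subtype.ext
    simp [fromBlocks_multiply, ← Matrix.transpose_mul, ← map_mul, mul_comm]

theorem SymplecticGroup.ofUnits_injective {l K L : Type*} [Fintype l] [DecidableEq l] [Field K]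
    [CommRing L] [Algebra K L] (b : Module.Basis l K L) :
    Function.Injective (SymplecticGroup.ofUnits b) := fun _ _ h ↦
  Units.ext (Algebra.leftMulMatrix_injective b
    (Matrix.fromBlocks_inj.1 (congrArg Subtype.val h)).1)

/-- The symplectic group `Sp (2 * e, K)` over a finite field has a cyclic subgroup of order `m`
for every divisor `m` of `#K ^ e - 1`. -/
theorem SymplecticGroup.exists_orderOf_eq {K : Type*} [Field K] [Finite K] {e m : ℕ} (he : e ≠ 0)
    (hm : m ∣ Nat.card K ^ e - 1) :
    ∃ g : Matrix.symplecticGroup (Fin e) K, orderOf g = m := by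
  obtain ⟨ℓ, _⟩ := CharP.exists K
  have : Fact ℓ.Prime := ⟨CharP.char_is_prime K ℓ⟩
  have : NeZero e := ⟨he⟩
  let L := FiniteField.Extension K ℓ e
  let b : Module.Basis (Fin e) K L :=
    Module.finBasisOfFinrankEq K L (FiniteField.finrank_extension K ℓ e)
  obtain ⟨u, hu⟩ := IsCyclic.exists_ofOrder_eq_natCard (α := Lˣ)
  have hcard : Nat.card Lˣ = Nat.card K ^ e - 1 := by
    rw [Nat.card_units, FiniteField.natCard_extension]
  refine ⟨SymplecticGroup.ofUnits b (u ^ (orderOf u / m)), ?_⟩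
  rw [orderOf_injective _ (SymplecticGroup.ofUnits_injective b)]
  exact orderOf_pow_orderOf_div (by rw [hu]; exact Nat.card_pos.ne') (by rwa [hu, hcard])

/-- Let `p` be an odd prime not dividing the prime power `q`, let `e` be the
multiplicative order of `q` mod `p` and suppose `e` is odd, and let `p^r` exactly
divide `q^e - 1`. Then every Sylow `p`-subgroup of `Sp_{2e}(F_q)` is cyclic of order
`p^r`. -/
theorem sylow_symplecticGroup_cyclic (p q : ℕ) (hp : p.Prime) (hodd : Odd p)
    (hq : IsPrimePow q) (hpq : ¬ p ∣ q)
    (F : Type) [Field F] [Fintype F] (hF : Fintype.card F = q)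
    (e r : ℕ) (he : orderOf (q : ZMod p) = e) (heodd : Odd e)
    (hr : p ^ r ∣ q ^ e - 1 ∧ ¬ p ^ (r + 1) ∣ q ^ e - 1)
    (P : Sylow p (Matrix.symplecticGroup (Fin e) F)) :
    IsCyclic (P : Subgroup (Matrix.symplecticGroup (Fin e) F)) ∧
      Nat.card (P : Subgroup (Matrix.symplecticGroup (Fin e) F)) = p ^ r := by
  have : Fact p.Prime := ⟨hp⟩
  have hFq : Nat.card F = q := by rw [Nat.card_eq_fintype_card, hF]
  have hpF : (p : F) ≠ 0 := by
    intro h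
    obtain ⟨n, hprime, hn⟩ := FiniteField.card F (ringChar F)
    have hdvd : ringChar F = p :=
      (Nat.prime_dvd_prime_iff_eq hprime hp).1 ((ringChar.spec F p).1 h)
    rw [hF, hdvd] at hn
    exact hpq (hn ▸ dvd_pow_self p n.ne_zero)
  have hqe : (q : ZMod p) ^ e = 1 := he ▸ pow_orderOf_eq_one _
  have hcop : p.Coprime (q ^ e + 1) := by
    refine (Nat.Prime.coprime_iff_not_dvd hp).2 fun h ↦ ?_
    have h2 := (ZMod.natCast_eq_zero_iff _ _).2 h
    push_cast at h2
    rw [hqe, one_add_one_eq_two] at h2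
    have h2' : p ∣ 2 := (ZMod.natCast_eq_zero_iff 2 p).1 (by exact_mod_cast h2)
    rw [(Nat.prime_dvd_prime_iff_eq hp Nat.prime_two).1 h2'] at hodd
    exact absurd hodd (by decide)
  obtain ⟨g, hg⟩ := SymplecticGroup.exists_orderOf_eq (K := F) heodd.pos.ne'
    (m := p ^ r) (by rw [hFq]; exact hr.1)
  have hgcard : Nat.card (Subgroup.zpowers g) = p ^ r := by rw [Nat.card_zpowers, hg]
  obtain ⟨Q, hQ⟩ := (IsPGroup.of_card hgcard).exists_le_sylow
  have hQcard : Nat.card Q ≤ p ^ r := by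
    obtain ⟨n, hn⟩ := IsPGroup.iff_card.1 Q.isPGroup'
    have hdvd := Q.isPGroup'.card_symplecticGroup_dvd hpF (by rw [hFq, he]) heodd
    rw [hn, hFq, show q ^ (2 * e) - 1 = (q ^ e + 1) * (q ^ e - 1) by
      rw [mul_comm, pow_mul]; simpa using Nat.sq_sub_sq (q ^ e) 1] at hdvd
    have hdvd' := (hcop.pow_left n).dvd_of_dvd_mul_left hdvd
    change Nat.card (Q : Subgroup (Matrix.symplecticGroup (Fin e) F)) ≤ p ^ r
    rw [hn]
    refine Nat.pow_le_pow_right hp.pos (not_lt.1 fun hlt ↦ hr.2 ?_)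
    exact (pow_dvd_pow p hlt).trans hdvd'
  have hQeq : Subgroup.zpowers g = (Q : Subgroup (Matrix.symplecticGroup (Fin e) F)) :=
    Subgroup.eq_of_le_of_card_ge hQ (by rw [hgcard]; exact hQcard)
  have hcyc : IsCyclic (Q : Subgroup (Matrix.symplecticGroup (Fin e) F)) :=
    hQeq ▸ inferInstance
  have hcardQ : Nat.card (Q : Subgroup (Matrix.symplecticGroup (Fin e) F)) = p ^ r :=
    hQeq ▸ hgcard
  have φ := Sylow.equiv Q P
  exact ⟨isCyclic_of_surjective φ φ.surjective, (Nat.card_congr φ.toEquiv).symm.trans hcardQ⟩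
end
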